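/- Let G be a 2-connected cubic (3-regular) finite simple graph, let 𝒪 be a set of pairwise edge-disjoint odd cycles of G, and let e be an edge of G. Then there exists a perfect matching (1-factor) F of G such that e ∈ E(F) and E(F) ∩ E(O) ≠ ∅ for every O ∈ 𝒪. -/

import Mathlib

open SimpleGraph

namespace PaperFormalization

variable {V : Type*}

/-- The degree of a vertex in a subgraph. -/
noncomputable def sdeg {G : SimpleGraph V} (H : G.Subgraph) (v : V) : ℕ :=
  (H.neighborSet v).ncard

/-- `H` is a `t`-factor of `G`: a spanning subgraph in which every vertex has degree `t`. -/
def IsTFactor {G : SimpleGraph V} (H : G.Subgraph) (t : ℕ) : Prop :=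
  H.IsSpanning ∧ ∀ v : V, sdeg H v = t

/-- A cycle of `G`: a connected 2-regular subgraph. -/
def IsCycleSG {G : SimpleGraph V} (C : G.Subgraph) : Prop :=
  C.Connected ∧ ∀ v ∈ C.verts, sdeg C v = 2

/-- An odd cycle: a cycle with an odd number of edges. -/
def IsOddCycleSG {G : SimpleGraph V} (C : G.Subgraph) : Prop :=
  IsCycleSG C ∧ Odd C.edgeSet.ncard

/-- A family of subgraphs is pairwise edge-disjoint. -/
def PairwiseEdgeDisjoint {G : SimpleGraph V} (𝒪 : Set G.Subgraph) : Prop :=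
  𝒪.Pairwise fun O₁ O₂ => Disjoint O₁.edgeSet O₂.edgeSet

/-- A family of subgraphs is pairwise vertex-disjoint. -/
def PairwiseVertexDisjoint {G : SimpleGraph V} (𝒪 : Set G.Subgraph) : Prop :=
  𝒪.Pairwise fun O₁ O₂ => Disjoint O₁.verts O₂.verts

/-- `G` is `r`-regular. -/
def IsRegular (G : SimpleGraph V) (r : ℕ) : Prop :=
  ∀ v : V, (G.neighborSet v).ncard = r

/-- `G` is 2-connected: connected, at least 3 vertices, and no cut vertex. -/
def TwoConnected [Fintype V] (G : SimpleGraph V) : Prop :=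
  G.Connected ∧ 3 ≤ Fintype.card V ∧ ∀ v : V, (G.induce {u | u ≠ v}).Connected

/-- `G` is `r`-connected: more than `r` vertices and deleting fewer than `r`
vertices leaves it connected. -/
def KConnected [Fintype V] (r : ℕ) (G : SimpleGraph V) : Prop :=
  r < Fintype.card V ∧ ∀ S : Set V, S.ncard < r → (G.induce Sᶜ).Connected

/-- A set of edges is a matching: pairwise non-adjacent edges. -/
def IsMatchingSet (M : Set (Sym2 V)) : Prop :=
  M.Pairwise fun e f => ∀ v : V, v ∈ e → v ∉ f

/-- A finite multigraph given by darts: `vert d` is the tail of `d`, `inv d` its reverse. -/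
structure DartGraph (V D : Type*) where
  vs : Finset V
  ds : Finset D
  vert : D → V
  inv : D → D

namespace DartGraph

variable {D : Type*}

open Classical in
/-- The number of edges leaving `U`. -/
noncomputable def cut (Γ : DartGraph V D) (U : Finset V) : ℕ :=
  (Γ.ds.filter fun d => Γ.vert d ∈ U ∧ Γ.vert (Γ.inv d) ∉ U).card

open Classical in
/-- Connected bridgeless cubic multigraphs. -/
structure IsCubic (Γ : DartGraph V D) : Prop where
  vert_mem : ∀ d ∈ Γ.ds, Γ.vert d ∈ Γ.vs
  inv_mem : ∀ d ∈ Γ.ds, Γ.inv d ∈ Γ.ds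
  inv_inv : ∀ d ∈ Γ.ds, Γ.inv (Γ.inv d) = d
  inv_ne : ∀ d ∈ Γ.ds, Γ.inv d ≠ d
  deg : ∀ v ∈ Γ.vs, (Γ.ds.filter fun d => Γ.vert d = v).card = 3
  two_le_cut : ∀ U ⊆ Γ.vs, U.Nonempty → U ≠ Γ.vs → 2 ≤ Γ.cut U

/-- Perfect matchings, as sets of darts. -/
structure IsPM (Γ : DartGraph V D) (M : Set D) : Prop where
  mem_ds : ∀ d ∈ M, d ∈ Γ.ds
  inv_mem : ∀ d ∈ M, Γ.inv d ∈ M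
  exists_mem : ∀ v ∈ Γ.vs, ∃ d ∈ M, Γ.vert d = v
  eq_of_vert_eq : ∀ d ∈ M, ∀ a ∈ M, Γ.vert d = Γ.vert a → d = a

/-- A symmetric set of darts whose complement covers every vertex. -/
structure IsAdm (Γ : DartGraph V D) (S : Set D) : Prop where
  inv_mem : ∀ d ∈ Γ.ds, d ∈ S → Γ.inv d ∈ S
  exists_notMem : ∀ v ∈ Γ.vs, ∃ d ∈ Γ.ds, Γ.vert d = v ∧ d ∉ S

/-- There is a perfect matching through `e` that makes `S` bipartite after its removal. -/
def Quells (Γ : DartGraph V D) (S : Set D) (e : D) : Prop :=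
  ∃ (M : Set D) (c : V → Bool), Γ.IsPM M ∧ e ∈ M ∧
    ∀ d ∈ Γ.ds, d ∈ S → d ∉ M → c (Γ.vert d) ≠ c (Γ.vert (Γ.inv d))

lemma even_card_of_symm (Γ : DartGraph V D) (hΓ : Γ.IsCubic) (T : Finset D) (hT : T ⊆ Γ.ds)
    (hinv : ∀ d ∈ T, Γ.inv d ∈ T) : Even T.card := by
  have h : ∑ d ∈ T, (1 : ZMod 2) = 0 :=
    Finset.sum_involution (fun d _ => Γ.inv d) (fun _ _ => by decide)
      (fun d hd _ => hΓ.inv_ne d (hT hd)) (fun d hd => hinv d hd)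
      (fun d hd => hΓ.inv_inv d (hT hd))
  rw [Finset.sum_const, nsmul_one] at h
  exact (ZMod.natCast_eq_zero_iff_even).1 h

open Classical in
/-- The darts of a symmetric set with tail in `U` and those leaving `U` agree in number mod 2. -/
lemma even_card_tail_iff {Γ : DartGraph V D} (hΓ : Γ.IsCubic) (T : Finset D) (hT : T ⊆ Γ.ds)
    (hinv : ∀ d ∈ T, Γ.inv d ∈ T) (U : Finset V) :
    Even (T.filter fun d => Γ.vert d ∈ U).card ↔
      Even (T.filter fun d => Γ.vert d ∈ U ∧ Γ.vert (Γ.inv d) ∉ U).card := by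
  have h1 : Even (T.filter fun d => Γ.vert d ∈ U ∧ Γ.vert (Γ.inv d) ∈ U).card := by
    apply even_card_of_symm Γ hΓ _ ((Finset.filter_subset _ _).trans hT)
    intro d hd
    simp only [Finset.mem_filter] at hd ⊢
    rw [hΓ.inv_inv d (hT hd.1)]
    exact ⟨hinv d hd.1, hd.2.2, hd.2.1⟩
  have h2 := Finset.card_filter_add_card_filter_not (s := T.filter fun d => Γ.vert d ∈ U)
    (fun d => Γ.vert (Γ.inv d) ∈ U)
  rw [Finset.filter_filter, Finset.filter_filter] at h2
  rw [← h2, Nat.even_add]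
  tauto

open Classical in
lemma card_tail {Γ : DartGraph V D} (hΓ : Γ.IsCubic) (U : Finset V) (hU : U ⊆ Γ.vs) :
    (Γ.ds.filter fun d => Γ.vert d ∈ U).card = 3 * U.card := by
  rw [Finset.card_eq_sum_card_fiberwise (f := Γ.vert) (t := U)]
  · rw [Finset.sum_congr rfl (g := fun _ => 3), Finset.sum_const, smul_eq_mul, mul_comm]
    intro v hv
    rw [← hΓ.deg v (hU hv), Finset.filter_filter]
    congr 1
    ext d
    simp only [Finset.mem_filter]
    constructor
    · tauto
    · rintro ⟨h, rfl⟩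
      exact ⟨h, hv, rfl⟩
  · intro d hd
    simpa using (Finset.mem_filter.1 hd).2

lemma even_cut_iff {Γ : DartGraph V D} (hΓ : Γ.IsCubic) (U : Finset V) (hU : U ⊆ Γ.vs) :
    Even (Γ.cut U) ↔ Even U.card := by
  classical
  have h := even_card_tail_iff hΓ Γ.ds subset_rfl hΓ.inv_mem U
  rw [card_tail hΓ U hU, Nat.even_mul] at h
  unfold cut
  rw [← h]
  have : ¬ Even 3 := by decide
  tauto

lemma cut_vs {Γ : DartGraph V D} (hΓ : Γ.IsCubic) : Γ.cut Γ.vs = 0 := by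
  classical
  unfold cut
  rw [Finset.card_eq_zero, Finset.filter_eq_empty_iff]
  intro d hd h
  exact h.2 (hΓ.vert_mem _ (hΓ.inv_mem d hd))

lemma even_card_vs {Γ : DartGraph V D} (hΓ : Γ.IsCubic) : Even Γ.vs.card := by
  rw [← even_cut_iff hΓ _ subset_rfl, cut_vs hΓ]
  exact Even.zero

open Classical in
lemma cut_sdiff_of_inv {Γ : DartGraph V D} (hvert : ∀ d ∈ Γ.ds, Γ.vert d ∈ Γ.vs)
    (hmem : ∀ d ∈ Γ.ds, Γ.inv d ∈ Γ.ds) (hinv : ∀ d ∈ Γ.ds, Γ.inv (Γ.inv d) = d) (U : Finset V) :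
    Γ.cut (Γ.vs \ U) = Γ.cut U := by
  unfold cut
  refine Finset.card_bij (fun d _ => Γ.inv d) ?_ ?_ ?_
  · intro d hd
    simp only [Finset.mem_filter, Finset.mem_sdiff] at hd ⊢
    have := hvert _ (hmem d hd.1)
    rw [hinv d hd.1]
    exact ⟨hmem d hd.1, by tauto, hd.2.1.2⟩
  · intro d hd d' hd' h
    simp only [Finset.mem_filter] at hd hd'
    rw [← hinv d hd.1, h, hinv d' hd'.1]
  · intro d hd
    simp only [Finset.mem_filter] at hd
    have h1 := hvert d hd.1
    have h2 := hvert _ (hmem d hd.1)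
    refine ⟨Γ.inv d, ?_, hinv d hd.1⟩
    simp only [Finset.mem_filter, Finset.mem_sdiff]
    rw [hinv d hd.1]
    exact ⟨hmem d hd.1, ⟨h2, hd.2.2⟩, fun h => h.2 hd.2.1⟩

open Classical in
lemma cut_sdiff {Γ : DartGraph V D} (hΓ : Γ.IsCubic) (U : Finset V) :
    Γ.cut (Γ.vs \ U) = Γ.cut U :=
  cut_sdiff_of_inv hΓ.vert_mem hΓ.inv_mem hΓ.inv_inv U

open Classical in
/-- The darts at a vertex, listed starting from a given one. -/
lemma exists_three {Γ : DartGraph V D} (hΓ : Γ.IsCubic) {d : D} (hd : d ∈ Γ.ds) :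
    ∃ d₂ d₃, d₂ ∈ Γ.ds ∧ d₃ ∈ Γ.ds ∧ Γ.vert d₂ = Γ.vert d ∧ Γ.vert d₃ = Γ.vert d ∧
      d₂ ≠ d ∧ d₃ ≠ d ∧ d₂ ≠ d₃ ∧
      ∀ d' ∈ Γ.ds, Γ.vert d' = Γ.vert d → d' = d ∨ d' = d₂ ∨ d' = d₃ := by
  have h := hΓ.deg _ (hΓ.vert_mem d hd)
  have hmem : d ∈ Γ.ds.filter fun d' => Γ.vert d' = Γ.vert d := by simp [hd]
  have h2 : ((Γ.ds.filter fun d' => Γ.vert d' = Γ.vert d).erase d).card = 2 := by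
    rw [Finset.card_erase_of_mem hmem, h]
  obtain ⟨a, b, hab, hs⟩ := Finset.card_eq_two.1 h2
  have ha : a ∈ (Γ.ds.filter fun d' => Γ.vert d' = Γ.vert d).erase d := by simp [hs]
  have hb : b ∈ (Γ.ds.filter fun d' => Γ.vert d' = Γ.vert d).erase d := by simp [hs]
  simp only [Finset.mem_erase, Finset.mem_filter] at ha hb
  refine ⟨a, b, ha.2.1, hb.2.1, ha.2.2, hb.2.2, ha.1, hb.1, hab, fun d' hd' hv => ?_⟩
  by_cases hdd : d' = d
  · exact Or.inl hdd
  · have : d' ∈ (Γ.ds.filter fun d' => Γ.vert d' = Γ.vert d).erase d := by simp [hdd, hd', hv]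
    rw [hs] at this
    simpa using Or.inr (by simpa using this)

lemma cut_singleton {Γ : DartGraph V D} (hΓ : Γ.IsCubic) {v : V} (hv : v ∈ Γ.vs) :
    Γ.cut {v} = 3 := by
  classical
  have h3 : Γ.cut {v} ≤ 3 := by
    rw [← hΓ.deg v hv]
    unfold cut
    apply Finset.card_le_card
    intro d hd
    simp only [Finset.mem_filter, Finset.mem_singleton] at hd ⊢
    exact ⟨hd.1, hd.2.1⟩
  have hsub : {v} ⊆ Γ.vs := by simpa using hv
  have hodd : ¬ Even (Γ.cut {v}) := by
    rw [even_cut_iff hΓ _ hsub]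
    simp
  have hne : ({v} : Finset V) ≠ Γ.vs := by
    intro h
    have := even_card_vs hΓ
    rw [← h] at this
    simp at this
  have h2 := hΓ.two_le_cut _ hsub ⟨v, by simp⟩ hne
  have : Γ.cut {v} ≠ 2 := fun h => hodd (by rw [h]; decide)
  omega

lemma vert_inv_ne {Γ : DartGraph V D} (hΓ : Γ.IsCubic) {d : D} (hd : d ∈ Γ.ds) :
    Γ.vert (Γ.inv d) ≠ Γ.vert d := by
  classical
  have h := cut_singleton hΓ (hΓ.vert_mem d hd)
  have h' := hΓ.deg _ (hΓ.vert_mem d hd)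
  rw [← h'] at h
  have hsub : (Γ.ds.filter fun d' => Γ.vert d' ∈ ({Γ.vert d} : Finset V) ∧
      Γ.vert (Γ.inv d') ∉ ({Γ.vert d} : Finset V)) ⊆
      Γ.ds.filter fun d' => Γ.vert d' = Γ.vert d := by
    intro d hd
    simp only [Finset.mem_filter, Finset.mem_singleton] at hd ⊢
    exact ⟨hd.1, hd.2.1⟩
  have heq := Finset.eq_of_subset_of_card_le hsub h.ge
  have : d ∈ Γ.ds.filter fun d' => Γ.vert d' = Γ.vert d := by simp [hd]
  rw [← heq] at this
  simpa using (Finset.mem_filter.1 this).2.2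

/-! ### Contracting one side of a cut with three edges -/

open Classical in
/-- Contract `U` to its element `u`. -/
noncomputable def contract (Γ : DartGraph V D) (U : Finset V) (u : V) : DartGraph V D where
  vs := insert u (Γ.vs \ U)
  ds := Γ.ds.filter fun d => ¬ (Γ.vert d ∈ U ∧ Γ.vert (Γ.inv d) ∈ U)
  vert := fun d => if Γ.vert d ∈ U then u else Γ.vert d
  inv := Γ.inv

lemma contract_isCubic {Γ : DartGraph V D} (hΓ : Γ.IsCubic) {U : Finset V} {u : V}
    (hU : U ⊆ Γ.vs) (hu : u ∈ U) (hcut : Γ.cut U = 3) : (Γ.contract U u).IsCubic := by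
  classical
  have hmem : ∀ d, d ∈ (Γ.contract U u).ds ↔
      d ∈ Γ.ds ∧ ¬ (Γ.vert d ∈ U ∧ Γ.vert (Γ.inv d) ∈ U) := by
    intro d; simp [contract]
  have hvert : ∀ d, (Γ.contract U u).vert d = if Γ.vert d ∈ U then u else Γ.vert d :=
    fun _ => rfl
  have hinv : (Γ.contract U u).inv = Γ.inv := rfl
  have hvs : ∀ v, v ∈ (Γ.contract U u).vs ↔ v = u ∨ v ∈ Γ.vs ∧ v ∉ U := by
    intro v; simp [contract]
  refine ⟨?_, ?_, ?_, ?_, ?_, ?_⟩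
  · intro d hd
    rw [hmem] at hd
    rw [hvs, hvert]
    have := hΓ.vert_mem d hd.1
    split_ifs <;> tauto
  · intro d hd
    rw [hmem] at hd ⊢
    rw [hinv, hΓ.inv_inv d hd.1]
    exact ⟨hΓ.inv_mem d hd.1, fun h => hd.2 h.symm⟩
  · intro d hd
    rw [hmem] at hd
    exact hΓ.inv_inv d hd.1
  · intro d hd
    rw [hmem] at hd
    exact hΓ.inv_ne d hd.1
  · intro v hv
    rw [hvs] at hv
    by_cases hvu : v = u
    · rw [← hcut]
      unfold cut
      congr 1
      ext d
      simp only [Finset.mem_filter, hmem, hvert, hvu]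
      split_ifs with h
      · tauto
      · have : Γ.vert d ≠ u := fun h' => h (h' ▸ hu)
        tauto
    · have hv' : v ∈ Γ.vs ∧ v ∉ U := by tauto
      rw [← hΓ.deg v hv'.1]
      congr 1
      ext d
      simp only [Finset.mem_filter, hmem, hvert]
      split_ifs with h
      · have : u ≠ v := fun h => hvu h.symm
        have : Γ.vert d ≠ v := fun h' => hv'.2 (h' ▸ h)
        tauto
      · tauto
  · intro W hW hne hneq
    set W' := Γ.vs.filter fun v => (if v ∈ U then u else v) ∈ W with hW'
    have hfix : ∀ w ∈ (Γ.contract U u).vs, (w ∈ W' ↔ w ∈ W) := by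
      intro w hw
      rw [hvs] at hw
      rw [hW', Finset.mem_filter]
      rcases hw with rfl | hw
      · simp [hu, hU hu]
      · simp [hw.1, hw.2]
    have hcutW : (Γ.contract U u).cut W = Γ.cut W' := by
      unfold cut
      congr 1
      ext d
      simp only [Finset.mem_filter, hmem, hvert, hinv, hW']
      constructor
      · rintro ⟨⟨h1, h2⟩, h3, h4⟩
        exact ⟨h1, ⟨hΓ.vert_mem d h1, h3⟩, fun h => h4 h.2⟩
      · rintro ⟨h1, ⟨h2, h3⟩, h4⟩
        have h5 := hΓ.vert_mem _ (hΓ.inv_mem d h1)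
        refine ⟨⟨h1, ?_⟩, h3, fun h => h4 ⟨h5, h⟩⟩
        rintro ⟨h6, h7⟩
        rw [if_pos h6] at h3
        rw [if_pos h7] at h4
        exact h4 ⟨h5, h3⟩
    rw [hcutW]
    apply hΓ.two_le_cut _ (Finset.filter_subset _ _)
    · obtain ⟨w, hw⟩ := hne
      exact ⟨w, (hfix w (hW hw)).2 hw⟩
    · intro h
      apply hneq
      apply Finset.Subset.antisymm hW
      intro w hw
      have h' : W' = Γ.vs := h
      rw [← hfix w hw, h']
      rw [hvs] at hw
      rcases hw with rfl | hw
      · exact hU hu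
      · exact hw.1

/-- The number of darts of `S` at each vertex is `0` or `2`. -/
def IsTwoReg (Γ : DartGraph V D) (S : Set D) : Prop :=
  ∀ d ∈ Γ.ds, d ∈ S → ∃ d' ∈ Γ.ds, Γ.vert d' = Γ.vert d ∧ d' ≠ d ∧ d' ∈ S

open Classical in
lemma even_card_at {Γ : DartGraph V D} (hΓ : Γ.IsCubic) {S : Set D} (hS : Γ.IsAdm S)
    (h2 : Γ.IsTwoReg S) {v : V} (hv : v ∈ Γ.vs) :
    Even ((Γ.ds.filter (· ∈ S)).filter fun d => Γ.vert d = v).card := by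
  obtain ⟨d, hd, rfl, hdS⟩ := hS.exists_notMem v hv
  obtain ⟨a, b, ha, hb, hva, hvb, had, hbd, hab, hall⟩ := exists_three hΓ hd
  by_cases haS : a ∈ S
  · have hbS : b ∈ S := by
      obtain ⟨a', ha', hva', hne, haS'⟩ := h2 a ha haS
      rcases hall a' ha' (hva'.trans hva) with rfl | rfl | rfl
      · exact absurd haS' hdS
      · exact absurd rfl hne
      · exact haS'
    have : ((Γ.ds.filter (· ∈ S)).filter fun d' => Γ.vert d' = Γ.vert d) = {a, b} := by
      ext d'
      simp only [Finset.mem_filter, Finset.mem_insert, Finset.mem_singleton]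
      constructor
      · rintro ⟨⟨h1, h3⟩, h4⟩
        rcases hall d' h1 h4 with rfl | h | h
        · exact absurd h3 hdS
        · exact Or.inl h
        · exact Or.inr h
      · rintro (rfl | rfl)
        · exact ⟨⟨ha, haS⟩, hva⟩
        · exact ⟨⟨hb, hbS⟩, hvb⟩
    rw [this, Finset.card_pair hab]
    decide
  · have hbS : b ∉ S := by
      intro hbS
      obtain ⟨b', hb', hvb', hne, hbS'⟩ := h2 b hb hbS
      rcases hall b' hb' (hvb'.trans hvb) with rfl | rfl | rfl
      · exact absurd hbS' hdS
      · exact haS hbS'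
      · exact absurd rfl hne
    have : ((Γ.ds.filter (· ∈ S)).filter fun d' => Γ.vert d' = Γ.vert d) = ∅ := by
      ext d'
      simp only [Finset.mem_filter, Finset.notMem_empty, iff_false]
      rintro ⟨⟨h1, h3⟩, h4⟩
      rcases hall d' h1 h4 with rfl | rfl | rfl <;> contradiction
    rw [this]
    simp

lemma contract_isAdm {Γ : DartGraph V D} (hΓ : Γ.IsCubic) {U : Finset V} {u : V}
    (hU : U ⊆ Γ.vs) (hcut : Γ.cut U = 3) {S : Set D} (hS : Γ.IsAdm S)
    (h2 : Γ.IsTwoReg S) : (Γ.contract U u).IsAdm S := by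
  classical
  have hmem : ∀ d, d ∈ (Γ.contract U u).ds ↔
      d ∈ Γ.ds ∧ ¬ (Γ.vert d ∈ U ∧ Γ.vert (Γ.inv d) ∈ U) := by
    intro d; simp [contract]
  have hvert : ∀ d, (Γ.contract U u).vert d = if Γ.vert d ∈ U then u else Γ.vert d :=
    fun _ => rfl
  have hvs : ∀ v, v ∈ (Γ.contract U u).vs ↔ v = u ∨ v ∈ Γ.vs ∧ v ∉ U := by
    intro v; simp [contract]
  refine ⟨fun d hd hdS => hS.inv_mem d ((hmem d).1 hd).1 hdS, fun v hv => ?_⟩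
  rw [hvs] at hv
  by_cases hvu : v = u
  · by_contra hcon
    push Not at hcon
    have hall : ∀ d ∈ Γ.ds, Γ.vert d ∈ U → Γ.vert (Γ.inv d) ∉ U → d ∈ S := by
      intro d hd h1 h3
      exact hcon d ((hmem d).2 ⟨hd, fun h => h3 h.2⟩) (by rw [hvert, if_pos h1, hvu])
    have heven : Even ((Γ.ds.filter (· ∈ S)).filter fun d => Γ.vert d ∈ U).card := by
      rw [Finset.card_eq_sum_card_fiberwise (f := Γ.vert) (t := U)
        (fun d hd => by simpa using (Finset.mem_filter.1 hd).2)]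
      apply Finset.even_sum
      intro v hv
      have := even_card_at hΓ hS h2 (hU hv)
      have heq : (((Γ.ds.filter (· ∈ S)).filter fun d => Γ.vert d ∈ U).filter
          fun d => Γ.vert d = v) = (Γ.ds.filter (· ∈ S)).filter fun d => Γ.vert d = v := by
        ext d
        simp only [Finset.mem_filter]
        constructor
        · tauto
        · rintro ⟨h, rfl⟩
          exact ⟨⟨h, hv⟩, rfl⟩
      rw [heq]
      exact this
    rw [even_card_tail_iff hΓ _ (Finset.filter_subset _ _)] at heven
    · have : ((Γ.ds.filter (· ∈ S)).filter fun d => Γ.vert d ∈ U ∧ Γ.vert (Γ.inv d) ∉ U).card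
          = 3 := by
        rw [← hcut]
        unfold cut
        congr 1
        ext d
        simp only [Finset.mem_filter]
        constructor
        · tauto
        · rintro ⟨h, h1, h3⟩
          exact ⟨⟨h, hall d h h1 h3⟩, h1, h3⟩
      rw [this] at heven
      exact absurd heven (by decide)
    · intro d hd
      simp only [Finset.mem_filter] at hd ⊢
      exact ⟨hΓ.inv_mem d hd.1, hS.inv_mem d hd.1 hd.2⟩
  · have hv' : v ∈ Γ.vs ∧ v ∉ U := by tauto
    obtain ⟨d, hd, hdv, hdS⟩ := hS.exists_notMem v hv'.1
    have : Γ.vert d ∉ U := by rw [hdv]; exact hv'.2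
    exact ⟨d, (hmem d).2 ⟨hd, fun h => this h.1⟩, by rw [hvert, if_neg this, hdv], hdS⟩

lemma IsAdm.diff {Γ : DartGraph V D} (hΓ : Γ.IsCubic) {S : Set D} (hS : Γ.IsAdm S) {d : D}
    (hd : d ∈ Γ.ds) : Γ.IsAdm (S \ {d, Γ.inv d}) := by
  refine ⟨fun a ha haS => ⟨hS.inv_mem a ha haS.1, ?_⟩, fun v hv => ?_⟩
  · have h := haS.2
    simp only [Set.mem_insert_iff, Set.mem_singleton_iff, not_or] at h ⊢
    refine ⟨fun h' => h.2 ?_, fun h' => h.1 ?_⟩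
    · rw [← h', hΓ.inv_inv a ha]
    · rw [← hΓ.inv_inv a ha, h', hΓ.inv_inv d hd]
  · obtain ⟨a, ha, hav, haS⟩ := hS.exists_notMem v hv
    exact ⟨a, ha, hav, fun h => haS h.1⟩

lemma Quells.of_diff_self {Γ : DartGraph V D} {S : Set D} {e : D}
    (h : Γ.Quells (S \ {e, Γ.inv e}) e) : Γ.Quells S e := by
  obtain ⟨M, c, hM, heM, hc⟩ := h
  refine ⟨M, c, hM, heM, fun d hd hdS hdM => hc d hd ⟨hdS, ?_⟩ hdM⟩
  rintro (rfl | rfl)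
  · exact hdM heM
  · exact hdM (hM.inv_mem _ heM)

lemma Quells.of_diff_pendant {Γ : DartGraph V D} (hΓ : Γ.IsCubic) {S : Set D} (hS : Γ.IsAdm S)
    {d e : D} (hd : d ∈ Γ.ds)
    (hpend : ∀ d' ∈ Γ.ds, Γ.vert d' = Γ.vert d → d' ∈ S → d' = d)
    (h : Γ.Quells (S \ {d, Γ.inv d}) e) : Γ.Quells S e := by
  classical
  obtain ⟨M, c, hM, heM, hc⟩ := h
  refine ⟨M, Function.update c (Γ.vert d) (!c (Γ.vert (Γ.inv d))), hM, heM, ?_⟩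
  intro a ha haS haM
  have hloop := vert_inv_ne hΓ hd
  by_cases h1 : a = d
  · subst h1
    simp [hloop]
  by_cases h2 : a = Γ.inv d
  · subst h2
    simp [hloop, hΓ.inv_inv d hd]
  have h3 : Γ.vert a ≠ Γ.vert d := fun h => h1 (hpend a ha h haS)
  have h4 : Γ.vert (Γ.inv a) ≠ Γ.vert d := fun h => h2 <| by
    rw [← hpend _ (hΓ.inv_mem a ha) h (hS.inv_mem a ha haS), hΓ.inv_inv a ha]
  rw [Function.update_of_ne h3, Function.update_of_ne h4]
  exact hc a ha ⟨haS, by simp [h1, h2]⟩ haM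

open Classical in
/-- Two perfect matchings on the contractions of the sides of a `3`-cut can be glued. -/
lemma Quells.glue {Γ : DartGraph V D} (hΓ : Γ.IsCubic) {S : Set D} {e : D} {U : Finset V}
    {u₀ u₁ : V} (hu₀ : u₀ ∈ U) (hu₁ : u₁ ∉ U)
    (heU : ¬ (Γ.vert e ∈ U ∧ Γ.vert (Γ.inv e) ∈ U))
    (h₁ : (Γ.contract U u₀).Quells S e)
    (h₂ : ∀ g ∈ (Γ.contract (Γ.vs \ U) u₁).ds, (Γ.contract (Γ.vs \ U) u₁).Quells S g) :
    Γ.Quells S e := by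
  classical
  obtain ⟨M₁, c₁, hM₁, heM₁, hc₁⟩ := h₁
  have hmem₁ : ∀ d, d ∈ (Γ.contract U u₀).ds ↔
      d ∈ Γ.ds ∧ ¬ (Γ.vert d ∈ U ∧ Γ.vert (Γ.inv d) ∈ U) := by
    intro d; simp [contract]
  have hmem₂ : ∀ d, d ∈ (Γ.contract (Γ.vs \ U) u₁).ds ↔
      d ∈ Γ.ds ∧ ¬ (Γ.vert d ∉ U ∧ Γ.vert (Γ.inv d) ∉ U) := by
    intro d
    simp only [contract, Finset.mem_filter, Finset.mem_sdiff]
    constructor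
    · rintro ⟨h, h'⟩
      exact ⟨h, fun h'' => h' ⟨⟨hΓ.vert_mem d h, h''.1⟩, hΓ.vert_mem _ (hΓ.inv_mem d h), h''.2⟩⟩
    · rintro ⟨h, h'⟩
      exact ⟨h, fun h'' => h' ⟨h''.1.2, h''.2.2⟩⟩
  have hvert₁ : ∀ d, (Γ.contract U u₀).vert d = if Γ.vert d ∈ U then u₀ else Γ.vert d :=
    fun _ => rfl
  have hvert₂ : ∀ d ∈ Γ.ds,
      (Γ.contract (Γ.vs \ U) u₁).vert d = if Γ.vert d ∈ U then Γ.vert d else u₁ := by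
    intro d hd
    have := hΓ.vert_mem d hd
    simp only [contract, Finset.mem_sdiff, this, true_and]
    by_cases h : Γ.vert d ∈ U <;> simp [h]
  have hinv₁ : ∀ d ∈ M₁, Γ.inv d ∈ M₁ := hM₁.inv_mem
  obtain ⟨g, hgM₁, hgv⟩ := hM₁.exists_mem u₀ (by simp [contract])
  obtain ⟨hg, hg'⟩ := (hmem₁ g).1 (hM₁.mem_ds g hgM₁)
  have hgU : Γ.vert g ∈ U := by
    by_contra h
    rw [hvert₁, if_neg h] at hgv
    exact h (hgv ▸ hu₀)
  have hgU' : Γ.vert (Γ.inv g) ∉ U := fun h => hg' ⟨hgU, h⟩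
  obtain ⟨M₂, c₂, hM₂, hgM₂, hc₂⟩ := h₂ g ((hmem₂ g).2 ⟨hg, fun h => h.1 hgU⟩)
  have hinv₂ : ∀ d ∈ M₂, Γ.inv d ∈ M₂ := hM₂.inv_mem
  have hout₁ : ∀ d ∈ Γ.ds, Γ.vert d ∈ U → d ∈ M₁ → d = g := by
    intro d hd h1 h2
    apply hM₁.eq_of_vert_eq d h2 g hgM₁
    rw [hvert₁, hvert₁, if_pos h1, if_pos hgU]
  have hout₂ : ∀ d ∈ Γ.ds, Γ.vert d ∉ U → d ∈ M₂ → d = Γ.inv g := by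
    intro d hd h1 h2
    apply hM₂.eq_of_vert_eq d h2 _ (hinv₂ g hgM₂)
    rw [hvert₂ _ hd, hvert₂ _ (hΓ.inv_mem g hg), if_neg h1, if_neg hgU']
  have hcross : ∀ d ∈ Γ.ds, Γ.vert d ∈ U → Γ.vert (Γ.inv d) ∉ U → (d ∈ M₁ ↔ d ∈ M₂) := by
    intro d hd h1 h2
    constructor
    · intro h
      rw [hout₁ d hd h1 h]
      exact hgM₂
    · intro h
      have := hout₂ _ (hΓ.inv_mem d hd) h2 (hinv₂ d h)
      rw [← hΓ.inv_inv d hd, this, hΓ.inv_inv g hg]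
      exact hgM₁
  have hcross' : ∀ d ∈ Γ.ds, Γ.vert d ∉ U → Γ.vert (Γ.inv d) ∈ U → (d ∈ M₁ ↔ d ∈ M₂) := by
    intro d hd h1 h2
    have := hcross _ (hΓ.inv_mem d hd) h2 (by rwa [hΓ.inv_inv d hd])
    constructor
    · intro h
      rw [← hΓ.inv_inv d hd]
      exact hinv₂ _ (this.1 (hinv₁ d h))
    · intro h
      rw [← hΓ.inv_inv d hd]
      exact hinv₁ _ (this.2 (hinv₂ d h))
  obtain ⟨c₂', hc₂u, hc₂'⟩ : ∃ c : V → Bool, c u₁ = !c₁ u₀ ∧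
      ∀ d ∈ (Γ.contract (Γ.vs \ U) u₁).ds, d ∈ S → d ∉ M₂ →
        c ((Γ.contract (Γ.vs \ U) u₁).vert d) ≠ c ((Γ.contract (Γ.vs \ U) u₁).vert (Γ.inv d)) := by
    by_cases h : c₂ u₁ = !c₁ u₀
    · exact ⟨c₂, h, hc₂⟩
    · refine ⟨fun v => !c₂ v, by simpa using h, fun d hd hdS hdM => ?_⟩
      have := hc₂ d hd hdS hdM
      intro h'
      exact this (Bool.not_inj h')
  refine ⟨{d | d ∈ Γ.ds ∧ (Γ.vert d ∈ U → d ∈ M₂) ∧ (Γ.vert d ∉ U → d ∈ M₁)},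
    fun v => if v ∈ U then c₂' v else c₁ v, ⟨fun d hd => hd.1, ?_, ?_, ?_⟩, ?_, ?_⟩
  · rintro d ⟨hd, hd1, hd2⟩
    refine ⟨hΓ.inv_mem d hd, fun h => ?_, fun h => ?_⟩
    · by_cases hdU : Γ.vert d ∈ U
      · exact hinv₂ d (hd1 hdU)
      · exact hinv₂ d ((hcross' d hd hdU h).1 (hd2 hdU))
    · by_cases hdU : Γ.vert d ∈ U
      · exact hinv₁ d ((hcross d hd hdU h).2 (hd1 hdU))
      · exact hinv₁ d (hd2 hdU)
  · intro v hv
    by_cases hvU : v ∈ U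
    · obtain ⟨d, hdM, hdv⟩ := hM₂.exists_mem v (by simp [contract, hvU, hv])
      have hd := ((hmem₂ d).1 (hM₂.mem_ds d hdM)).1
      rw [hvert₂ d hd] at hdv
      have hdU : Γ.vert d ∈ U := by
        by_contra h
        rw [if_neg h] at hdv
        exact hu₁ (hdv ▸ hvU)
      rw [if_pos hdU] at hdv
      exact ⟨d, ⟨hd, fun _ => hdM, fun h => absurd hdU h⟩, hdv⟩
    · obtain ⟨d, hdM, hdv⟩ := hM₁.exists_mem v (by simp [contract, hvU, hv])
      have hd := ((hmem₁ d).1 (hM₁.mem_ds d hdM)).1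
      rw [hvert₁ d] at hdv
      have hdU : Γ.vert d ∉ U := by
        intro h
        rw [if_pos h] at hdv
        exact hvU (hdv ▸ hu₀)
      rw [if_neg hdU] at hdv
      exact ⟨d, ⟨hd, fun h => absurd h hdU, fun _ => hdM⟩, hdv⟩
  · rintro d ⟨hd, hd1, hd2⟩ d' ⟨hd', hd1', hd2'⟩ h
    by_cases hdU : Γ.vert d ∈ U
    · have hdU' := h ▸ hdU
      apply hM₂.eq_of_vert_eq d (hd1 hdU) d' (hd1' hdU')
      rw [hvert₂ d hd, hvert₂ d' hd', h]
    · have hdU' := h ▸ hdU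
      apply hM₁.eq_of_vert_eq d (hd2 hdU) d' (hd2' hdU')
      rw [hvert₁ d, hvert₁ d', h]
  · have he := ((hmem₁ e).1 (hM₁.mem_ds e heM₁)).1
    exact ⟨he, fun h => (hcross e he h fun h' => heU ⟨h, h'⟩).1 heM₁, fun _ => heM₁⟩
  · intro d hd hdS hdM
    have hdi := hΓ.inv_mem d hd
    have k1 : ¬ (Γ.vert d ∈ U ∧ Γ.vert (Γ.inv d) ∈ U) → d ∉ M₁ →
        c₁ (if Γ.vert d ∈ U then u₀ else Γ.vert d) ≠
          c₁ (if Γ.vert (Γ.inv d) ∈ U then u₀ else Γ.vert (Γ.inv d)) :=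
      fun h h' => hc₁ d ((hmem₁ d).2 ⟨hd, h⟩) hdS h'
    have k2 : ¬ (Γ.vert d ∉ U ∧ Γ.vert (Γ.inv d) ∉ U) → d ∉ M₂ →
        c₂' (if Γ.vert d ∈ U then Γ.vert d else u₁) ≠
          c₂' (if Γ.vert (Γ.inv d) ∈ U then Γ.vert (Γ.inv d) else u₁) := by
      intro h h'
      rw [← hvert₂ d hd, ← hvert₂ _ hdi]
      exact hc₂' d ((hmem₂ d).2 ⟨hd, h⟩) hdS h'
    have hdM' : ¬ ((Γ.vert d ∈ U → d ∈ M₂) ∧ (Γ.vert d ∉ U → d ∈ M₁)) := fun h => hdM ⟨hd, h⟩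
    by_cases hdU : Γ.vert d ∈ U
    · have hn2 : d ∉ M₂ := fun h => hdM' ⟨fun _ => h, fun h' => absurd hdU h'⟩
      have := k2 (fun h => h.1 hdU) hn2
      by_cases hiU : Γ.vert (Γ.inv d) ∈ U
      · simpa [hdU, hiU] using this
      · have hn1 : d ∉ M₁ := fun h => hn2 ((hcross d hd hdU hiU).1 h)
        have h1 := k1 (fun h => hiU h.2) hn1
        simp only [hdU, hiU, if_true, if_false, hc₂u] at this h1 ⊢
        revert this h1
        cases c₂' (Γ.vert d) <;> cases c₁ u₀ <;> cases c₁ (Γ.vert (Γ.inv d)) <;> simp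
    · have hn1 : d ∉ M₁ := fun h => hdM' ⟨fun h' => absurd h' hdU, fun _ => h⟩
      have := k1 (fun h => hdU h.1) hn1
      by_cases hiU : Γ.vert (Γ.inv d) ∈ U
      · have hn2 : d ∉ M₂ := fun h => hn1 ((hcross' d hd hdU hiU).2 h)
        have h1 := k2 (fun h => h.2 hiU) hn2
        simp only [hdU, hiU, if_true, if_false, hc₂u] at this h1 ⊢
        revert this h1
        cases c₁ (Γ.vert d) <;> cases c₁ u₀ <;> cases c₂' (Γ.vert (Γ.inv d)) <;> simp
      · simpa [hdU, hiU] using this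

lemma quells_of_card_eq_two {Γ : DartGraph V D} (hΓ : Γ.IsCubic) (S : Set D) {e : D}
    (he : e ∈ Γ.ds) (h2 : Γ.vs.card = 2) : Γ.Quells S e := by
  classical
  have hie := hΓ.inv_mem e he
  have hie' := hΓ.inv_inv e he
  have hne := vert_inv_ne hΓ he
  have hvs : {Γ.vert e, Γ.vert (Γ.inv e)} = Γ.vs := by
    apply Finset.eq_of_subset_of_card_le
    · intro v hv
      simp only [Finset.mem_insert, Finset.mem_singleton] at hv
      rcases hv with rfl | rfl
      · exact hΓ.vert_mem e he
      · exact hΓ.vert_mem _ hie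
    · rw [h2, Finset.card_pair hne.symm]
  have hcov : ∀ v ∈ Γ.vs, v = Γ.vert e ∨ v = Γ.vert (Γ.inv e) := by
    intro v hv
    rw [← hvs] at hv
    simpa using hv
  refine ⟨{e, Γ.inv e}, fun v => decide (v = Γ.vert e), ⟨?_, ?_, ?_, ?_⟩, by simp, ?_⟩
  · rintro d (rfl | rfl) <;> assumption
  · rintro d (rfl | rfl)
    · simp
    · simp [hie']
  · intro v hv
    rcases hcov v hv with rfl | rfl
    · exact ⟨e, by simp, rfl⟩
    · exact ⟨Γ.inv e, by simp, rfl⟩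
  · rintro d (rfl | rfl) d' (rfl | rfl) h
    · rfl
    · exact absurd h.symm hne
    · exact absurd h hne
    · rfl
  · intro d hd _ _
    have h1 := hcov _ (hΓ.vert_mem d hd)
    have h2 := hcov _ (hΓ.vert_mem _ (hΓ.inv_mem d hd))
    have h3 := vert_inv_ne hΓ hd
    rcases h1 with h1 | h1 <;> rcases h2 with h2 | h2
    · exact absurd (h2.trans h1.symm) h3
    · simp [h1, h2, hne]
    · simp [h1, h2, hne]
    · exact absurd (h2.trans h1.symm) h3

open Classical in
/-- The number of edges between two vertices. -/
noncomputable def mult (Γ : DartGraph V D) (u v : V) : ℕ :=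
  (Γ.ds.filter fun d => Γ.vert d = u ∧ Γ.vert (Γ.inv d) = v).card

lemma mult_comm {Γ : DartGraph V D} (hΓ : Γ.IsCubic) (u v : V) : Γ.mult u v = Γ.mult v u := by
  classical
  unfold mult
  refine Finset.card_bij (fun d _ => Γ.inv d) ?_ ?_ ?_
  · intro d hd
    simp only [Finset.mem_filter] at hd ⊢
    rw [hΓ.inv_inv d hd.1]
    exact ⟨hΓ.inv_mem d hd.1, hd.2.2, hd.2.1⟩
  · intro d hd d' hd' h
    simp only [Finset.mem_filter] at hd hd'
    rw [← hΓ.inv_inv d hd.1, h, hΓ.inv_inv d' hd'.1]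
  · intro d hd
    simp only [Finset.mem_filter] at hd
    refine ⟨Γ.inv d, ?_, hΓ.inv_inv d hd.1⟩
    simp only [Finset.mem_filter]
    rw [hΓ.inv_inv d hd.1]
    exact ⟨hΓ.inv_mem d hd.1, hd.2.2, hd.2.1⟩

lemma mult_self {Γ : DartGraph V D} (hΓ : Γ.IsCubic) (u : V) : Γ.mult u u = 0 := by
  classical
  unfold mult
  rw [Finset.card_eq_zero, Finset.filter_eq_empty_iff]
  rintro d hd ⟨rfl, h⟩
  exact vert_inv_ne hΓ hd h

lemma sum_mult {Γ : DartGraph V D} (hΓ : Γ.IsCubic) {u : V} (hu : u ∈ Γ.vs) :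
    ∑ v ∈ Γ.vs, Γ.mult u v = 3 := by
  classical
  rw [← hΓ.deg u hu, Finset.card_eq_sum_card_fiberwise (f := fun d => Γ.vert (Γ.inv d)) (t := Γ.vs)]
  · simp only [mult, Finset.filter_filter]
  · intro d hd
    exact hΓ.vert_mem _ (hΓ.inv_mem d (Finset.mem_filter.1 hd).1)

lemma exists_of_mult_pos {Γ : DartGraph V D} {u v : V} (h : 0 < Γ.mult u v) :
    ∃ d ∈ Γ.ds, Γ.vert d = u ∧ Γ.vert (Γ.inv d) = v := by
  classical
  obtain ⟨d, hd⟩ := Finset.card_pos.1 h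
  exact ⟨d, by simpa using hd⟩

lemma eq_of_mult_le_one {Γ : DartGraph V D} {u v : V} (h : Γ.mult u v ≤ 1) {d d' : D}
    (hd : d ∈ Γ.ds) (hd' : d' ∈ Γ.ds) (hu : Γ.vert d = u) (hv : Γ.vert (Γ.inv d) = v)
    (hu' : Γ.vert d' = u) (hv' : Γ.vert (Γ.inv d') = v) : d = d' := by
  classical
  exact Finset.card_le_one.1 h d (by simp [*]) d' (by simp [*])

lemma mult_pos {Γ : DartGraph V D} {d : D} (hd : d ∈ Γ.ds) :
    0 < Γ.mult (Γ.vert d) (Γ.vert (Γ.inv d)) := by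
  classical
  exact Finset.card_pos.2 ⟨d, by simp [hd]⟩

lemma quells_of_card_eq_four {Γ : DartGraph V D} (hΓ : Γ.IsCubic) (S : Set D) {e : D}
    (he : e ∈ Γ.ds) (h4 : Γ.vs.card = 4) : Γ.Quells S e := by
  classical
  have hie := hΓ.inv_mem e he
  have hie' := hΓ.inv_inv e he
  have hne := vert_inv_ne hΓ he
  obtain ⟨x, hx⟩ : ∃ x, Γ.vert e = x := ⟨_, rfl⟩
  obtain ⟨y, hy⟩ : ∃ y, Γ.vert (Γ.inv e) = y := ⟨_, rfl⟩
  have hpos := mult_pos he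
  rw [hx, hy] at hne hpos
  have hxm : x ∈ Γ.vs := hx ▸ hΓ.vert_mem e he
  have hym : y ∈ Γ.vs := hy ▸ hΓ.vert_mem _ hie
  have hc2 : ((Γ.vs.erase x).erase y).card = 2 := by
    rw [Finset.card_erase_of_mem (by simp [hne, hym]), Finset.card_erase_of_mem hxm, h4]
  obtain ⟨z, w, hzw, hs⟩ := Finset.card_eq_two.1 hc2
  have hz : z ∈ (Γ.vs.erase x).erase y := by simp [hs]
  have hw : w ∈ (Γ.vs.erase x).erase y := by simp [hs]
  simp only [Finset.mem_erase] at hz hw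
  obtain ⟨hzy, hzx, hzm⟩ := hz
  obtain ⟨hwy, hwx, hwm⟩ := hw
  have hvs : Γ.vs = {x, y, z, w} := by
    rw [← hs, Finset.insert_erase (by simp [hne, hym]), Finset.insert_erase hxm]
  have hsum : ∀ u ∈ Γ.vs, Γ.mult u x + (Γ.mult u y + (Γ.mult u z + Γ.mult u w)) = 3 := by
    intro u hu
    rw [← sum_mult hΓ hu, hvs, Finset.sum_insert, Finset.sum_insert, Finset.sum_pair hzw]
    · simp [hzy.symm, hwy.symm]
    · simp [hne.symm, hzx.symm, hwx.symm]
  have sx := hsum x hxm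
  have sy := hsum y hym
  have sz := hsum z hzm
  have sw := hsum w hwm
  rw [mult_self hΓ] at sx sy sz sw
  rw [mult_comm hΓ y x] at sy
  rw [mult_comm hΓ z x, mult_comm hΓ z y] at sz
  rw [mult_comm hΓ w x, mult_comm hΓ w y, mult_comm hΓ w z] at sw
  obtain ⟨f, hf, hfz, hfw⟩ := exists_of_mult_pos (Γ := Γ) (u := z) (v := w) (by omega)
  have hif := hΓ.inv_mem f hf
  have hif' := hΓ.inv_inv f hf
  have hPM : Γ.IsPM {e, Γ.inv e, f, Γ.inv f} := by
    refine ⟨?_, ?_, ?_, ?_⟩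
    · rintro d (rfl | rfl | rfl | rfl) <;> assumption
    · rintro d (rfl | rfl | rfl | rfl)
      · simp
      · simp [hie']
      · simp
      · simp [hif']
    · intro v hv
      rw [hvs] at hv
      simp only [Finset.mem_insert, Finset.mem_singleton] at hv
      rcases hv with rfl | rfl | rfl | rfl
      · exact ⟨e, by simp, hx⟩
      · exact ⟨Γ.inv e, by simp, hy⟩
      · exact ⟨f, by simp, hfz⟩
      · exact ⟨Γ.inv f, by simp, hfw⟩
    · rintro d (rfl | rfl | rfl | rfl) d' (rfl | rfl | rfl | rfl) h <;>
        first
          | rfl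
          | (simp only [hx, hy, hfz, hfw] at h; subst h; contradiction)
  have key : ∀ c : V → Bool,
      (∀ d ∈ Γ.ds, d ∉ ({e, Γ.inv e, f, Γ.inv f} : Set D) →
        c (Γ.vert d) ≠ c (Γ.vert (Γ.inv d))) → Γ.Quells S e :=
    fun c hc => ⟨_, c, hPM, by simp, fun d hd _ hdM => hc d hd hdM⟩
  have hcov : ∀ d ∈ Γ.ds, Γ.vert d = x ∨ Γ.vert d = y ∨ Γ.vert d = z ∨ Γ.vert d = w := by
    intro d hd
    have := hΓ.vert_mem d hd
    rw [hvs] at this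
    simpa using this
  rcases (show Γ.mult x y = 1 ∨ Γ.mult x z = 0 ∨ Γ.mult x w = 0 by omega) with h | h | h
  · apply key (fun v => decide (v = x ∨ v = y))
    intro d hd hdM
    simp only [Set.mem_insert_iff, Set.mem_singleton_iff, not_or] at hdM
    have hid := hΓ.inv_mem d hd
    have hid' := hΓ.inv_inv d hd
    have hv' : Γ.vert (Γ.inv (Γ.inv d)) = Γ.vert d := by rw [hid']
    have hloop := vert_inv_ne hΓ hd
    rcases hcov d hd with h1 | h1 | h1 | h1 <;> rcases hcov _ hid with h2 | h2 | h2 | h2 <;>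
      simp [h1, h2, hne, hzx, hzy, hwx, hwy] at hloop ⊢
    · exact hdM.1 (eq_of_mult_le_one h.le hd he h1 h2 hx hy)
    · exact hdM.2.1 (by rw [← eq_of_mult_le_one h.le hid he h2 (hv'.trans h1) hx hy, hid'])
    · exact hdM.2.2.1 (eq_of_mult_le_one (by omega) hd hf h1 h2 hfz hfw)
    · exact hdM.2.2.2 (by
        rw [← eq_of_mult_le_one (by omega) hid hf h2 (hv'.trans h1) hfz hfw, hid'])
  · apply key (fun v => decide (v = x ∨ v = z))
    intro d hd hdM
    have hid := hΓ.inv_mem d hd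
    have hloop := vert_inv_ne hΓ hd
    have hm := mult_pos hd
    have hm' := mult_comm hΓ (Γ.vert d) (Γ.vert (Γ.inv d))
    rcases hcov d hd with h1 | h1 | h1 | h1 <;> rcases hcov _ hid with h2 | h2 | h2 | h2 <;>
      simp [h1, h2, hne, hne.symm, hzx, hzy, hwx, hwy, hzw, hzw.symm, hzy.symm] at hloop hm hm' ⊢ <;>
      omega
  · apply key (fun v => decide (v = x ∨ v = w))
    intro d hd hdM
    have hid := hΓ.inv_mem d hd
    have hloop := vert_inv_ne hΓ hd
    have hm := mult_pos hd
    have hm' := mult_comm hΓ (Γ.vert d) (Γ.vert (Γ.inv d))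
    rcases hcov d hd with h1 | h1 | h1 | h1 <;> rcases hcov _ hid with h2 | h2 | h2 | h2 <;>
      simp [h1, h2, hne, hne.symm, hzx, hzy, hwx, hwy, hzw, hzw.symm, hwy.symm] at hloop hm hm' ⊢ <;>
      omega

open Classical in
lemma cut_erase {Γ : DartGraph V D} (hΓ : Γ.IsCubic) {U : Finset V} {a : V} (ha : a ∈ U)
    (haΓ : a ∈ Γ.vs) :
    Γ.cut (U.erase a) + 2 * (Γ.ds.filter fun d => Γ.vert d = a ∧ Γ.vert (Γ.inv d) ∉ U).card
      = Γ.cut U + 3 := by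
  have hloop : ∀ d ∈ Γ.ds, Γ.vert (Γ.inv d) ≠ Γ.vert d := fun d => vert_inv_ne hΓ
  have h1 : (Γ.ds.filter fun d => Γ.vert d ∈ U ∧ Γ.vert (Γ.inv d) = a ∧ Γ.vert d ≠ a).card =
      (Γ.ds.filter fun d => Γ.vert d = a ∧ Γ.vert (Γ.inv d) ∈ U).card := by
    refine Finset.card_bij (fun d _ => Γ.inv d) ?_ ?_ ?_
    · intro d hd
      simp only [Finset.mem_filter] at hd ⊢
      rw [hΓ.inv_inv d hd.1]
      exact ⟨hΓ.inv_mem d hd.1, hd.2.2.1, hd.2.1⟩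
    · intro d hd d' hd' h
      simp only [Finset.mem_filter] at hd hd'
      rw [← hΓ.inv_inv d hd.1, h, hΓ.inv_inv d' hd'.1]
    · intro d hd
      simp only [Finset.mem_filter] at hd
      refine ⟨Γ.inv d, ?_, hΓ.inv_inv d hd.1⟩
      simp only [Finset.mem_filter]
      rw [hΓ.inv_inv d hd.1]
      exact ⟨hΓ.inv_mem d hd.1, hd.2.2, hd.2.1, fun h => hloop d hd.1 (h.trans hd.2.1.symm)⟩
  have h2 := Finset.card_filter_add_card_filter_not (s := Γ.ds.filter fun d => Γ.vert d = a)
    (fun d => Γ.vert (Γ.inv d) ∈ U)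
  rw [Finset.filter_filter, Finset.filter_filter, hΓ.deg a haΓ] at h2
  have h3 := Finset.card_filter_add_card_filter_not
    (s := Γ.ds.filter fun d => Γ.vert d ∈ U ∧ Γ.vert (Γ.inv d) ∉ U) (fun d => Γ.vert d = a)
  rw [Finset.filter_filter, Finset.filter_filter] at h3
  have h4 := Finset.card_filter_add_card_filter_not
    (s := Γ.ds.filter fun d => Γ.vert d ∈ U.erase a ∧ Γ.vert (Γ.inv d) ∉ U.erase a)
    (fun d => Γ.vert (Γ.inv d) = a)
  rw [Finset.filter_filter, Finset.filter_filter] at h4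
  have e1 : (Γ.ds.filter fun d => (Γ.vert d ∈ U ∧ Γ.vert (Γ.inv d) ∉ U) ∧ Γ.vert d = a) =
      Γ.ds.filter fun d => Γ.vert d = a ∧ Γ.vert (Γ.inv d) ∉ U := by
    ext d
    simp only [Finset.mem_filter]
    constructor
    · tauto
    · rintro ⟨h, rfl, h'⟩
      exact ⟨h, ⟨ha, h'⟩, rfl⟩
  have e2 : (Γ.ds.filter fun d => (Γ.vert d ∈ U.erase a ∧ Γ.vert (Γ.inv d) ∉ U.erase a) ∧
      Γ.vert (Γ.inv d) = a) =
      Γ.ds.filter fun d => Γ.vert d ∈ U ∧ Γ.vert (Γ.inv d) = a ∧ Γ.vert d ≠ a := by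
    ext d
    simp only [Finset.mem_filter, Finset.mem_erase]
    tauto
  have e3 : (Γ.ds.filter fun d => (Γ.vert d ∈ U.erase a ∧ Γ.vert (Γ.inv d) ∉ U.erase a) ∧
      ¬ Γ.vert (Γ.inv d) = a) =
      Γ.ds.filter fun d => (Γ.vert d ∈ U ∧ Γ.vert (Γ.inv d) ∉ U) ∧ ¬ Γ.vert d = a := by
    ext d
    simp only [Finset.mem_filter, Finset.mem_erase]
    constructor
    · tauto
    · rintro ⟨h, ⟨h1, h2⟩, h3⟩
      have : Γ.vert (Γ.inv d) ≠ a := fun h => h2 (h ▸ ha)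
      tauto
  rw [e1] at h3
  rw [e2, e3, h1] at h4
  unfold cut
  omega

/-- Every edge cut separating at least two vertices on both sides has at least four edges. -/
def NoSmallCut (Γ : DartGraph V D) : Prop :=
  ∀ U ⊆ Γ.vs, 2 ≤ U.card → U.card + 2 ≤ Γ.vs.card → 4 ≤ Γ.cut U

lemma noSmallCut_of {Γ : DartGraph V D} (hΓ : Γ.IsCubic) (h6 : 6 ≤ Γ.vs.card)
    (h : ∀ U ⊆ Γ.vs, Γ.cut U = 3 → 3 ≤ U.card → Γ.vs.card < U.card + 3) : Γ.NoSmallCut := by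
  classical
  have heven := even_card_vs hΓ
  have hno : ∀ U ⊆ Γ.vs, 4 ≤ U.card → U.card + 2 ≤ Γ.vs.card → Γ.cut U ≠ 2 := by
    intro U hU h4 hUc hcut
    have hpos : 0 < Γ.cut U := by omega
    obtain ⟨d, hd⟩ := Finset.card_pos.1 hpos
    simp only [Finset.mem_filter] at hd
    have haΓ := hΓ.vert_mem d hd.1
    have he := cut_erase hΓ hd.2.1 haΓ
    have hk : 0 < (Γ.ds.filter fun d' => Γ.vert d' = Γ.vert d ∧ Γ.vert (Γ.inv d') ∉ U).card :=
      Finset.card_pos.2 ⟨d, by simp [hd.1, hd.2.2]⟩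
    have hsub : U.erase (Γ.vert d) ⊆ Γ.vs := (Finset.erase_subset _ _).trans hU
    have hUe : Even U.card := (even_cut_iff hΓ U hU).1 (by rw [hcut]; decide)
    have hcard := Finset.card_erase_of_mem hd.2.1
    have hodd : ¬ Even (Γ.cut (U.erase (Γ.vert d))) := by
      rw [even_cut_iff hΓ _ hsub, hcard]
      rw [Nat.even_iff] at *
      omega
    have h2 := hΓ.two_le_cut _ hsub (Finset.card_pos.1 (by omega))
      (fun h' => by rw [h'] at hcard; omega)
    have h3 : Γ.cut (U.erase (Γ.vert d)) = 3 := by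
      rw [Nat.even_iff] at hodd
      omega
    have := h _ hsub h3 (by omega)
    omega
  intro U hU h2 hUc
  have hc2 := hΓ.two_le_cut U hU (Finset.card_pos.1 (by omega)) (fun h' => by rw [h'] at hUc; omega)
  have hcard := Finset.card_sdiff_add_card_eq_card hU
  have hcut := cut_sdiff hΓ U
  have hpar := even_cut_iff hΓ U hU
  by_contra hlt
  rcases (show Γ.cut U = 3 ∨ Γ.cut U = 2 by omega) with h3 | h3
  · have := h U hU h3
    rw [Nat.even_iff, Nat.even_iff] at hpar
    rw [Nat.even_iff] at heven
    omega
  · rcases Nat.lt_or_ge U.card 4 with h4 | h4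
    · refine hno (Γ.vs \ U) Finset.sdiff_subset ?_ ?_ (hcut.trans h3)
      · rw [Nat.even_iff, Nat.even_iff] at hpar
        omega
      · omega
    · exact hno U hU h4 hUc h3

open Classical in
lemma cut_add_card_le {Γ : DartGraph V D} (hΓ : Γ.IsCubic) {U : Finset V} {a : V} (ha : a ∈ U)
    (haΓ : a ∈ Γ.vs) (T : Finset D)
    (hT : ∀ d ∈ T, d ∈ Γ.ds ∧ Γ.vert d = a ∧ Γ.vert (Γ.inv d) ∈ U) :
    Γ.cut U + 2 * T.card ≤ Γ.cut (U.erase a) + 3 := by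
  have h := cut_erase hΓ ha haΓ
  have h2 := Finset.card_filter_add_card_filter_not (s := Γ.ds.filter fun d => Γ.vert d = a)
    (fun d => Γ.vert (Γ.inv d) ∈ U)
  rw [Finset.filter_filter, Finset.filter_filter, hΓ.deg a haΓ] at h2
  have h3 : T.card ≤ (Γ.ds.filter fun d => Γ.vert d = a ∧ Γ.vert (Γ.inv d) ∈ U).card :=
    Finset.card_le_card fun d hd => Finset.mem_filter.2 (hT d hd)
  omega

lemma NoSmallCut.eq_of_parallel {Γ : DartGraph V D} (hcut : Γ.NoSmallCut) (hΓ : Γ.IsCubic)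
    (h6 : 6 ≤ Γ.vs.card) {d d' : D} (hd : d ∈ Γ.ds) (hd' : d' ∈ Γ.ds)
    (h1 : Γ.vert d = Γ.vert d') (h2 : Γ.vert (Γ.inv d) = Γ.vert (Γ.inv d')) : d = d' := by
  classical
  by_contra hne
  have hu := hΓ.vert_mem d hd
  have hv := hΓ.vert_mem _ (hΓ.inv_mem d hd)
  have huv := vert_inv_ne hΓ hd
  have h4 := hcut {Γ.vert d, Γ.vert (Γ.inv d)} (by
    intro v h
    simp only [Finset.mem_insert, Finset.mem_singleton] at h
    rcases h with rfl | rfl <;> assumption) (by rw [Finset.card_pair huv.symm])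
    (by rw [Finset.card_pair huv.symm]; omega)
  have hk := cut_add_card_le hΓ (U := {Γ.vert d, Γ.vert (Γ.inv d)})
    (Finset.mem_insert_self _ _) hu {d, d'} (by
    intro a ha
    simp only [Finset.mem_insert, Finset.mem_singleton] at ha
    rcases ha with rfl | rfl
    · exact ⟨hd, rfl, by simp⟩
    · exact ⟨hd', h1.symm, by simp [h2]⟩)
  rw [Finset.erase_insert (by simpa using huv.symm), cut_singleton hΓ hv,
    Finset.card_pair hne] at hk
  omega

lemma NoSmallCut.no_triangle {Γ : DartGraph V D} (hcut : Γ.NoSmallCut) (hΓ : Γ.IsCubic)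
    (h6 : 6 ≤ Γ.vs.card) {a b c : D} (ha : a ∈ Γ.ds) (hb : b ∈ Γ.ds) (hc : c ∈ Γ.ds)
    (hab : Γ.vert (Γ.inv a) = Γ.vert b) (hbc : Γ.vert (Γ.inv b) = Γ.vert c)
    (hca : Γ.vert (Γ.inv c) = Γ.vert a) : False := by
  classical
  have hla := vert_inv_ne hΓ ha
  have hlb := vert_inv_ne hΓ hb
  have hlc := vert_inv_ne hΓ hc
  rw [hab] at hla
  rw [hbc] at hlb
  rw [hca] at hlc
  have hu := hΓ.vert_mem a ha
  have hv := hΓ.vert_mem b hb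
  have hw := hΓ.vert_mem c hc
  have hc2 : ({Γ.vert b, Γ.vert c} : Finset V).card = 2 := Finset.card_pair hlb.symm
  have hc3 : ({Γ.vert a, Γ.vert b, Γ.vert c} : Finset V).card = 3 := by
    rw [Finset.card_insert_of_notMem (by simp [hla.symm, hlc]), hc2]
  have h4 := hcut {Γ.vert a, Γ.vert b, Γ.vert c} (by
    intro v h
    simp only [Finset.mem_insert, Finset.mem_singleton] at h
    rcases h with rfl | rfl | rfl <;> assumption) (by omega) (by omega)
  have hk := cut_add_card_le hΓ (U := {Γ.vert a, Γ.vert b, Γ.vert c})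
    (Finset.mem_insert_self _ _) hu {a, Γ.inv c} (by
    intro d hd
    simp only [Finset.mem_insert, Finset.mem_singleton] at hd
    rcases hd with rfl | rfl
    · exact ⟨ha, rfl, by simp [hab]⟩
    · exact ⟨hΓ.inv_mem c hc, hca, by simp [hΓ.inv_inv c hc]⟩)
  rw [Finset.erase_insert (by simp [hla.symm, hlc]), Finset.card_pair
    (by rintro rfl; rw [hΓ.inv_inv c hc] at hab; exact hlb hab)] at hk
  have hk' := cut_add_card_le hΓ (U := {Γ.vert b, Γ.vert c})
    (Finset.mem_insert_self _ _) hv {b} (by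
    intro d hd
    simp only [Finset.mem_singleton] at hd
    rcases hd with rfl
    exact ⟨hb, rfl, by simp [hbc]⟩)
  rw [Finset.erase_insert (by simp [hlb.symm]), cut_singleton hΓ hw,
    Finset.card_singleton] at hk'
  omega

open Classical in
/-- Delete the vertices of `R` and join the dangling darts up as prescribed by `j`. -/
noncomputable def rewire (Γ : DartGraph V D) (R : Finset V) (j : D → D) : DartGraph V D where
  vs := Γ.vs \ R
  ds := Γ.ds.filter fun d => Γ.vert d ∉ R
  vert := Γ.vert
  inv := fun d => if Γ.vert (Γ.inv d) ∈ R then j d else Γ.inv d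

open Classical in
/-- The darts that enter `R`. -/
noncomputable def into (Γ : DartGraph V D) (R : Finset V) : Finset D :=
  Γ.ds.filter fun d => Γ.vert d ∉ R ∧ Γ.vert (Γ.inv d) ∈ R

lemma rewire_isCubic {Γ : DartGraph V D} (hΓ : Γ.IsCubic) (hcut : Γ.NoSmallCut) {R : Finset V}
    {j : D → D} (hj : ∀ d ∈ Γ.into R, j d ∈ Γ.into R ∧ j (j d) = d ∧ Γ.vert (j d) ≠ Γ.vert d)
    (hcard : (Γ.into R).card ≤ 6) : (Γ.rewire R j).IsCubic := by
  classical
  have hinto : ∀ d, d ∈ Γ.into R ↔ d ∈ Γ.ds ∧ Γ.vert d ∉ R ∧ Γ.vert (Γ.inv d) ∈ R := by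
    intro d; simp [into]
  have hmem : ∀ d, d ∈ (Γ.rewire R j).ds ↔ d ∈ Γ.ds ∧ Γ.vert d ∉ R := by
    intro d; simp [rewire]
  have hvs : ∀ v, v ∈ (Γ.rewire R j).vs ↔ v ∈ Γ.vs ∧ v ∉ R := by
    intro d; simp [rewire]
  have hvert : (Γ.rewire R j).vert = Γ.vert := rfl
  have hinv : ∀ d, (Γ.rewire R j).inv d = if Γ.vert (Γ.inv d) ∈ R then j d else Γ.inv d :=
    fun _ => rfl
  have h1 : ∀ d ∈ (Γ.rewire R j).ds, Γ.vert d ∈ (Γ.rewire R j).vs := by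
    intro d hd
    rw [hmem] at hd
    rw [hvs]
    exact ⟨hΓ.vert_mem d hd.1, hd.2⟩
  have h2 : ∀ d ∈ (Γ.rewire R j).ds, (Γ.rewire R j).inv d ∈ (Γ.rewire R j).ds := by
    intro d hd
    rw [hmem] at hd
    rw [hinv, hmem]
    split_ifs with h
    · have := (hinto _).1 (hj d ((hinto d).2 ⟨hd.1, hd.2, h⟩)).1
      exact ⟨this.1, this.2.1⟩
    · exact ⟨hΓ.inv_mem d hd.1, h⟩
  have h3 : ∀ d ∈ (Γ.rewire R j).ds, (Γ.rewire R j).inv ((Γ.rewire R j).inv d) = d := by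
    intro d hd
    rw [hmem] at hd
    rw [hinv d]
    split_ifs with h
    · have := hj d ((hinto d).2 ⟨hd.1, hd.2, h⟩)
      rw [hinv, if_pos ((hinto _).1 this.1).2.2, this.2.1]
    · rw [hinv, hΓ.inv_inv d hd.1, if_neg hd.2]
  have h4 : ∀ d ∈ (Γ.rewire R j).ds, Γ.vert ((Γ.rewire R j).inv d) ≠ Γ.vert d := by
    intro d hd
    rw [hmem] at hd
    rw [hinv d]
    split_ifs with h
    · exact (hj d ((hinto d).2 ⟨hd.1, hd.2, h⟩)).2.2
    · exact vert_inv_ne hΓ hd.1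
  have hdeg : ∀ v ∈ (Γ.rewire R j).vs,
      ((Γ.rewire R j).ds.filter fun d => Γ.vert d = v).card = 3 := by
    intro v hv
    rw [hvs] at hv
    rw [← hΓ.deg v hv.1]
    congr 1
    ext d
    simp only [Finset.mem_filter, hmem]
    constructor
    · tauto
    · rintro ⟨h, rfl⟩
      exact ⟨⟨h, hv.2⟩, rfl⟩
  refine ⟨h1, h2, h3, fun d hd h => h4 d hd (by rw [h]), hdeg, ?_⟩
  have hone : ∀ v ∈ (Γ.rewire R j).vs, (Γ.rewire R j).cut {v} = 3 := by
    intro v hv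
    rw [← hdeg v hv]
    unfold cut
    congr 1
    ext d
    simp only [Finset.mem_filter, Finset.mem_singleton, hvert]
    constructor
    · tauto
    · rintro ⟨h, rfl⟩
      exact ⟨h, rfl, h4 d h⟩
  have hsplit : ∀ W ⊆ (Γ.rewire R j).vs, Γ.cut W = (Γ.rewire R j).cut W +
      ((Γ.into R).filter fun d => Γ.vert d ∈ W ∧ Γ.vert (j d) ∈ W).card := by
    intro W hW
    have hWR : ∀ v ∈ W, v ∉ R := fun v hv => ((hvs v).1 (hW hv)).2
    unfold cut
    rw [← Finset.card_union_of_disjoint]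
    · congr 1
      ext d
      simp only [Finset.mem_union, Finset.mem_filter, hmem, hinto, hvert, hinv]
      constructor
      · rintro ⟨h1, h2, h3⟩
        by_cases h : Γ.vert (Γ.inv d) ∈ R
        · by_cases hjd : Γ.vert (j d) ∈ W
          · exact Or.inr ⟨⟨h1, hWR _ h2, h⟩, h2, hjd⟩
          · exact Or.inl ⟨⟨h1, hWR _ h2⟩, h2, by rwa [if_pos h]⟩
        · exact Or.inl ⟨⟨h1, hWR _ h2⟩, h2, by rwa [if_neg h]⟩
      · rintro (⟨⟨h1, _⟩, h2, h3⟩ | ⟨⟨h1, _, h⟩, h2, h3⟩)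
        · refine ⟨h1, h2, fun h => h3 ?_⟩
          rwa [if_neg (hWR _ h)]
        · exact ⟨h1, h2, fun h' => hWR _ h' h⟩
    · rw [Finset.disjoint_left]
      intro d hd hd'
      simp only [Finset.mem_filter, hinto, hvert, hinv] at hd hd'
      rw [if_pos hd'.1.2.2] at hd
      exact hd.2.2 hd'.2.2
  have hpar : ∀ W : Finset V,
      Even ((Γ.into R).filter fun d => Γ.vert d ∈ W ∧ Γ.vert (j d) ∈ W).card := by
    intro W
    have h : ∑ d ∈ (Γ.into R).filter fun d => Γ.vert d ∈ W ∧ Γ.vert (j d) ∈ W, (1 : ZMod 2) = 0 := by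
      refine Finset.sum_involution (fun d _ => j d) (fun _ _ => by decide) ?_ ?_ ?_
      · intro d hd _ h
        exact (hj d (Finset.mem_filter.1 hd).1).2.2 (by rw [h])
      · intro d hd
        rw [Finset.mem_filter] at hd ⊢
        have := hj d hd.1
        rw [this.2.1]
        exact ⟨this.1, hd.2.symm⟩
      · intro d hd
        exact (hj d (Finset.mem_filter.1 hd).1).2.1
    rw [Finset.sum_const, nsmul_one] at h
    exact (ZMod.natCast_eq_zero_iff_even).1 h
  intro W hW hne hneq
  by_contra hlt
  have hW' : (Γ.rewire R j).vs \ W ⊆ (Γ.rewire R j).vs := Finset.sdiff_subset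
  have hcompl := cut_sdiff_of_inv h1 h2 h3 W
  have two : ∀ X ⊆ (Γ.rewire R j).vs, X.Nonempty → (Γ.rewire R j).cut X < 2 → 2 ≤ X.card := by
    intro X hX hXne hXcut
    by_contra hXc
    have := Finset.card_pos.2 hXne
    obtain ⟨v, rfl⟩ := Finset.card_eq_one.1 (show X.card = 1 by omega)
    have := hone v (hX (by simp))
    omega
  have c1 := two W hW hne (by omega)
  have c2 := two _ hW' (by
    rw [Finset.sdiff_nonempty]
    exact fun h => hneq (hW.antisymm h)) (by omega)
  have hsub : (Γ.rewire R j).vs ⊆ Γ.vs := fun v hv => ((hvs v).1 hv).1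
  have hcards := Finset.card_sdiff_add_card_eq_card hW
  have hle := Finset.card_le_card hsub
  have e1 := hcut W (hW.trans hsub) c1 (by omega)
  have e2 := hcut _ (hW'.trans hsub) c2 (by omega)
  rw [hsplit W hW] at e1
  rw [hsplit _ hW'] at e2
  have p1 := hpar W
  have p2 := hpar ((Γ.rewire R j).vs \ W)
  have hsum : ((Γ.into R).filter fun d => Γ.vert d ∈ W ∧ Γ.vert (j d) ∈ W).card +
      ((Γ.into R).filter fun d => Γ.vert d ∈ (Γ.rewire R j).vs \ W ∧
        Γ.vert (j d) ∈ (Γ.rewire R j).vs \ W).card ≤ (Γ.into R).card := by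
    rw [← Finset.card_union_of_disjoint]
    · apply Finset.card_le_card
      exact Finset.union_subset (Finset.filter_subset _ _) (Finset.filter_subset _ _)
    · rw [Finset.disjoint_left]
      intro d hd hd'
      simp only [Finset.mem_filter, Finset.mem_sdiff] at hd hd'
      exact hd'.2.1.2 hd.2.1
  rw [Nat.even_iff] at p1 p2
  omega

/-- Extend a perfect matching and a colouring from a rewired graph to the deleted vertices. -/
lemma Quells.lift {Γ : DartGraph V D} (hΓ : Γ.IsCubic) {R : Finset V} {j : D → D} {S S' M' X : Set D}
    {e : D} {c' c : V → Bool} (hS : Γ.IsAdm S) (hM' : (Γ.rewire R j).IsPM M') (heM' : e ∈ M')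
    (hc' : ∀ d ∈ (Γ.rewire R j).ds, d ∈ S' → d ∉ M' →
      c' ((Γ.rewire R j).vert d) ≠ c' ((Γ.rewire R j).vert ((Γ.rewire R j).inv d)))
    (hS' : ∀ d ∈ S, Γ.vert (Γ.inv d) ∉ R → d ∈ S')
    (hX : ∀ d ∈ X, d ∈ Γ.ds ∧ Γ.vert d ∈ R)
    (hXR : ∀ d ∈ X, Γ.vert (Γ.inv d) ∈ R → Γ.inv d ∈ X)
    (hXM : ∀ d ∈ X, Γ.vert (Γ.inv d) ∉ R → Γ.inv d ∈ M')
    (hMX : ∀ d ∈ M', d ∈ Γ.into R → Γ.inv d ∈ X)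
    (hcov : ∀ v ∈ R, ∃ d ∈ X, Γ.vert d = v)
    (huniq : ∀ d ∈ X, ∀ d' ∈ X, Γ.vert d = Γ.vert d' → d = d')
    (hcc' : ∀ v ∉ R, c v = c' v)
    (hc : ∀ d ∈ Γ.ds, Γ.vert d ∈ R → d ∈ S → d ∉ X → c (Γ.vert d) ≠ c (Γ.vert (Γ.inv d))) :
    Γ.Quells S e := by
  classical
  have hinto : ∀ d, d ∈ Γ.into R ↔ d ∈ Γ.ds ∧ Γ.vert d ∉ R ∧ Γ.vert (Γ.inv d) ∈ R := by
    intro d; simp [into]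
  have hmem : ∀ d, d ∈ (Γ.rewire R j).ds ↔ d ∈ Γ.ds ∧ Γ.vert d ∉ R := by
    intro d; simp [rewire]
  have hinv : ∀ d, (Γ.rewire R j).inv d = if Γ.vert (Γ.inv d) ∈ R then j d else Γ.inv d :=
    fun _ => rfl
  have hM'm : ∀ d ∈ M', d ∈ Γ.ds ∧ Γ.vert d ∉ R := fun d hd => (hmem d).1 (hM'.mem_ds d hd)
  have hMinv : ∀ d ∈ M' ∪ X, Γ.inv d ∈ M' ∪ X := by
    rintro d (hd | hd)
    · by_cases h : Γ.vert (Γ.inv d) ∈ R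
      · exact Or.inr (hMX d hd ((hinto d).2 ⟨(hM'm d hd).1, (hM'm d hd).2, h⟩))
      · have := hM'.inv_mem d hd
        rw [hinv, if_neg h] at this
        exact Or.inl this
    · by_cases h : Γ.vert (Γ.inv d) ∈ R
      · exact Or.inr (hXR d hd h)
      · exact Or.inl (hXM d hd h)
  refine ⟨M' ∪ X, c, ⟨?_, hMinv, ?_, ?_⟩, Or.inl heM', ?_⟩
  · rintro d (hd | hd)
    · exact (hM'm d hd).1
    · exact (hX d hd).1
  · intro v hv
    by_cases h : v ∈ R
    · obtain ⟨d, hd, hdv⟩ := hcov v h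
      exact ⟨d, Or.inr hd, hdv⟩
    · obtain ⟨d, hd, hdv⟩ := hM'.exists_mem v (by simp [rewire, hv, h])
      exact ⟨d, Or.inl hd, hdv⟩
  · rintro d (hd | hd) d' (hd' | hd') h
    · exact hM'.eq_of_vert_eq d hd d' hd' h
    · exact absurd (h ▸ (hX d' hd').2) (hM'm d hd).2
    · exact absurd (h ▸ (hX d hd).2) (hM'm d' hd').2
    · exact huniq d hd d' hd' h
  · intro d hd hdS hdM
    by_cases hR : Γ.vert d ∈ R
    · exact hc d hd hR hdS fun h => hdM (Or.inr h)
    by_cases hR' : Γ.vert (Γ.inv d) ∈ R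
    · have := hc _ (hΓ.inv_mem d hd) hR' (hS.inv_mem d hd hdS) (fun h => hdM (by
        rw [← hΓ.inv_inv d hd]
        exact hMinv _ (Or.inr h)))
      rw [hΓ.inv_inv d hd] at this
      exact this.symm
    · have := hc' d ((hmem d).2 ⟨hd, hR⟩) (hS' d hdS hR') fun h => hdM (Or.inl h)
      rw [hinv, if_neg hR'] at this
      rw [hcc' _ hR, hcc' _ hR']
      exact this

/-- `a`, `b`, `c` are the three darts at a vertex. -/
structure IsStar (Γ : DartGraph V D) (a b c : D) : Prop where
  mem_left : a ∈ Γ.ds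
  mem_mid : b ∈ Γ.ds
  mem_right : c ∈ Γ.ds
  vert_mid : Γ.vert b = Γ.vert a
  vert_right : Γ.vert c = Γ.vert a
  mid_ne_left : b ≠ a
  right_ne_left : c ≠ a
  mid_ne_right : b ≠ c
  cover : ∀ d ∈ Γ.ds, Γ.vert d = Γ.vert a → d = a ∨ d = b ∨ d = c

lemma exists_isStar {Γ : DartGraph V D} (hΓ : Γ.IsCubic) {d : D} (hd : d ∈ Γ.ds) :
    ∃ d₂ d₃, Γ.IsStar d d₂ d₃ := by
  obtain ⟨a, b, h1, h2, h3, h4, h5, h6, h7, h8⟩ := exists_three hΓ hd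
  exact ⟨a, b, hd, h1, h2, h3, h4, h5, h6, h7, h8⟩

lemma IsStar.swap {Γ : DartGraph V D} {a b c : D} (h : Γ.IsStar a b c) : Γ.IsStar a c b :=
  ⟨h.mem_left, h.mem_right, h.mem_mid, h.vert_right, h.vert_mid, h.right_ne_left, h.mid_ne_left,
    h.mid_ne_right.symm, fun d hd hv => by have := h.cover d hd hv; tauto⟩

lemma IsStar.not_all_mem {Γ : DartGraph V D} (hΓ : Γ.IsCubic) {S : Set D} (hS : Γ.IsAdm S)
    {a b c : D} (h : Γ.IsStar a b c) : ¬ (a ∈ S ∧ b ∈ S ∧ c ∈ S) := by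
  obtain ⟨d, hd, hv, hdS⟩ := hS.exists_notMem _ (hΓ.vert_mem a h.mem_left)
  rintro ⟨ha, hb, hc⟩
  rcases h.cover d hd hv with rfl | rfl | rfl <;> contradiction

lemma exists_two_swaps {a b c d : D} (hab : a ≠ b) (hac : a ≠ c) (had : a ≠ d) (hbc : b ≠ c)
    (hbd : b ≠ d) (hcd : c ≠ d) : ∃ j : D → D, j a = b ∧ j b = a ∧ j c = d ∧ j d = c := by
  classical
  refine ⟨fun x => if x = a then b else if x = b then a else if x = c then d else c, ?_⟩
  simp [hab.symm, hac.symm, had.symm, hbc.symm, hbd.symm, hcd.symm]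

lemma exists_two_colors (p q : Bool) (P Q R : Prop) (h : P → Q → R → p ≠ q) :
    ∃ a b : Bool, (P → a ≠ p) ∧ (Q → a ≠ b) ∧ (R → b ≠ q) := by
  by_cases hP : P
  · by_cases hQ : Q
    · refine ⟨!p, p, by simp, by simp, fun hR => h hP hQ hR⟩
    · exact ⟨!p, !q, by simp, fun h => absurd h hQ, by simp⟩
  · exact ⟨q, !q, fun h => absurd h hP, by simp, by simp⟩

/-- `Γ` is a cubic graph without parallel edges and triangles such that the theorem holds for all
smaller cubic graphs. -/
structure IsMinimal (Γ : DartGraph V D) : Prop where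
  isCubic : Γ.IsCubic
  noSmallCut : Γ.NoSmallCut
  six_le : 6 ≤ Γ.vs.card
  quells : ∀ Γ' : DartGraph V D, Γ'.IsCubic → Γ'.vs.card < Γ.vs.card →
    ∀ S, Γ'.IsAdm S → ∀ e ∈ Γ'.ds, Γ'.Quells S e

lemma IsMinimal.quells_rewire {Γ : DartGraph V D} (hΓ : Γ.IsMinimal) {R : Finset V}
    {j : D → D} (hj : ∀ d ∈ Γ.into R, j d ∈ Γ.into R ∧ j (j d) = d ∧ Γ.vert (j d) ≠ Γ.vert d)
    (hcard : (Γ.into R).card ≤ 6) (hR : R ⊆ Γ.vs) (hne : R.Nonempty) {S' : Set D}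
    (hS' : (Γ.rewire R j).IsAdm S') {e : D} (he : e ∈ Γ.ds) (heR : Γ.vert e ∉ R) :
    (Γ.rewire R j).Quells S' e := by
  classical
  refine hΓ.quells _ (rewire_isCubic hΓ.isCubic hΓ.noSmallCut hj hcard) ?_ S' hS' e
    (by simp [rewire, he, heR])
  have h := Finset.card_sdiff_add_card_eq_card hR
  have := Finset.card_pos.2 hne
  have h' : (Γ.rewire R j).vs.card = (Γ.vs \ R).card := by
    unfold rewire
    congr
  omega

lemma IsMinimal.quells_of_edge {Γ : DartGraph V D} (hΓ : Γ.IsMinimal) {S : Set D}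
    (hS : Γ.IsAdm S) {e f g h k l : D} (he : e ∈ Γ.ds) (hf : f ∈ Γ.ds) (hef : f ≠ e)
    (hefv : Γ.vert f = Γ.vert e) (hz : Γ.IsStar (Γ.inv f) g h) (hw : Γ.IsStar (Γ.inv g) k l)
    (hgS : g ∉ S → f ∉ S ∧ h ∉ S ∧ k ∉ S ∧ l ∉ S) : Γ.Quells S e := by
  classical
  have hC := hΓ.isCubic
  have inv2 := hC.inv_inv
  have invm := hC.inv_mem
  have par : ∀ {d d' : D}, d ∈ Γ.ds → d' ∈ Γ.ds → Γ.vert d = Γ.vert d' →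
      Γ.vert (Γ.inv d) = Γ.vert (Γ.inv d') → d = d' :=
    fun h1 h2 => hΓ.noSmallCut.eq_of_parallel hC hΓ.six_le h1 h2
  have tri : ∀ {a b c : D}, a ∈ Γ.ds → b ∈ Γ.ds → c ∈ Γ.ds → Γ.vert (Γ.inv a) = Γ.vert b →
      Γ.vert (Γ.inv b) = Γ.vert c → Γ.vert (Γ.inv c) = Γ.vert a → False :=
    fun h1 h2 h3 => hΓ.noSmallCut.no_triangle hC hΓ.six_le h1 h2 h3
  have hg := hz.mem_mid
  have hh := hz.mem_right
  have hk := hw.mem_mid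
  have hl := hw.mem_right
  have vg := hz.vert_mid
  have vh := hz.vert_right
  have vk := hw.vert_mid
  have vl := hw.vert_right
  obtain ⟨z, hzdef⟩ : ∃ z, Γ.vert (Γ.inv f) = z := ⟨_, rfl⟩
  obtain ⟨w, hwdef⟩ : ∃ w, Γ.vert (Γ.inv g) = w := ⟨_, rfl⟩
  rw [hzdef] at vg vh
  rw [hwdef] at vk vl
  have hzw : z ≠ w := by
    rw [← vg, ← hwdef]
    exact (vert_inv_ne hC hg).symm
  have ig := inv2 g hg
  have ih := inv2 h hh
  have ik := inv2 k hk
  have il := inv2 l hl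
  have if' := inv2 f hf
  have vig : Γ.vert (Γ.inv (Γ.inv g)) = z := by rw [ig, vg]
  -- vertices outside `R`
  have hxz : Γ.vert f ≠ z := by
    rw [← hzdef]
    exact (vert_inv_ne hC hf).symm
  have hxw : Γ.vert f ≠ w := fun h' => hz.mid_ne_left <| by
    rw [par hf (invm g hg) (h'.trans hwdef.symm) (hzdef.trans vig.symm), ig]
  have hhz : Γ.vert (Γ.inv h) ≠ z := by
    rw [← vh]
    exact vert_inv_ne hC hh
  have hhw : Γ.vert (Γ.inv h) ≠ w := fun h' => hz.mid_ne_right <|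
    par hg hh (vg.trans vh.symm) (hwdef.trans h'.symm)
  have hkw : Γ.vert (Γ.inv k) ≠ w := by
    rw [← vk]
    exact vert_inv_ne hC hk
  have hkz : Γ.vert (Γ.inv k) ≠ z := fun h' => hw.mid_ne_left <|
    par hk (invm g hg) (vk.trans hwdef.symm) (h'.trans vig.symm)
  have hlw : Γ.vert (Γ.inv l) ≠ w := by
    rw [← vl]
    exact vert_inv_ne hC hl
  have hlz : Γ.vert (Γ.inv l) ≠ z := fun h' => hw.right_ne_left <|
    par hl (invm g hg) (vl.trans hwdef.symm) (h'.trans vig.symm)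
  have hfk : Γ.vert f ≠ Γ.vert (Γ.inv k) := fun h' =>
    tri hf hg hk (hzdef.trans vg.symm) (hwdef.trans vk.symm) h'.symm
  have hhl : Γ.vert (Γ.inv h) ≠ Γ.vert (Γ.inv l) := fun h' =>
    tri hg hl (invm h hh) (hwdef.trans vl.symm) h'.symm (by rw [ih, vh, vg])
  have hzcov : ∀ d ∈ Γ.ds, Γ.vert d = z → d = Γ.inv f ∨ d = g ∨ d = h := fun d hd hv =>
    hz.cover d hd (hv.trans hzdef.symm)
  have hwcov : ∀ d ∈ Γ.ds, Γ.vert d = w → d = Γ.inv g ∨ d = k ∨ d = l := fun d hd hv =>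
    hw.cover d hd (hv.trans hwdef.symm)
  have hR : ∀ v, v ∈ ({z, w} : Finset V) ↔ v = z ∨ v = w := by simp
  obtain ⟨j, j1, j2, j3, j4⟩ := exists_two_swaps (a := f) (b := Γ.inv k) (c := Γ.inv h)
    (d := Γ.inv l) (fun h' => hfk (by rw [← h'])) (fun h' => hz.right_ne_left (by rw [h', ih]))
    (fun h' => hzw (by rw [← hzdef, ← vl, h', il]))
    (fun h' => hzw (by rw [← vh, ← vk, ← ik, h', ih]))
    (fun h' => hw.mid_ne_right (by rw [← ik, h', il])) (fun h' => hhl (by rw [h']))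
  have hinto : ∀ d, d ∈ Γ.into {z, w} ↔ d = f ∨ d = Γ.inv k ∨ d = Γ.inv h ∨ d = Γ.inv l := by
    intro d
    simp only [into, Finset.mem_filter, hR, not_or]
    constructor
    · rintro ⟨hd, ⟨h1, h2⟩, h3 | h3⟩
      · rcases hzcov _ (invm d hd) h3 with h4 | h4 | h4 <;> have h5 := inv2 d hd <;> rw [h4] at h5
        · exact Or.inl (h5.symm.trans if')
        · exact absurd (h5 ▸ hwdef) h2
        · simp [h5]
      · rcases hwcov _ (invm d hd) h3 with h4 | h4 | h4 <;> have h5 := inv2 d hd <;> rw [h4] at h5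
        · exact absurd (h5 ▸ vig) h1
        · simp [h5]
        · simp [h5]
    · rintro (rfl | rfl | rfl | rfl)
      · exact ⟨hf, ⟨hxz, hxw⟩, Or.inl hzdef⟩
      · exact ⟨invm k hk, ⟨hkz, hkw⟩, by rw [ik]; exact Or.inr vk⟩
      · exact ⟨invm h hh, ⟨hhz, hhw⟩, by rw [ih]; exact Or.inl vh⟩
      · exact ⟨invm l hl, ⟨hlz, hlw⟩, by rw [il]; exact Or.inr vl⟩
  have hj : ∀ d ∈ Γ.into {z, w}, j d ∈ Γ.into {z, w} ∧ j (j d) = d ∧ Γ.vert (j d) ≠ Γ.vert d := by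
    intro d hd
    rw [hinto] at hd
    rcases hd with rfl | rfl | rfl | rfl <;>
      simp [hinto, j1, j2, j3, j4, hfk, hfk.symm, hhl, hhl.symm]
  have hcard : (Γ.into {z, w}).card ≤ 6 := by
    have : Γ.into {z, w} ⊆ {f, Γ.inv k, Γ.inv h, Γ.inv l} := by
      intro d hd
      simpa using (hinto d).1 hd
    exact (Finset.card_le_card this).trans (Finset.card_le_four.trans (by norm_num))
  have hsym : ∀ d ∈ Γ.ds, (Γ.inv d ∈ S ↔ d ∈ S) := fun d hd =>
    ⟨fun h' => by rw [← inv2 d hd]; exact hS.inv_mem _ (invm d hd) h', hS.inv_mem d hd⟩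
  set S' : Set D := {d | (d ∈ S ∧ Γ.vert (Γ.inv d) ∉ ({z, w} : Finset V)) ∨
    ((f ∈ S ∧ g ∈ S ∧ k ∈ S) ∧ (d = f ∨ d = Γ.inv k))} with hS'def
  have hinv : ∀ d, (Γ.rewire {z, w} j).inv d =
    if Γ.vert (Γ.inv d) ∈ ({z, w} : Finset V) then j d else Γ.inv d := fun _ => rfl
  have hinvB : ∀ d ∈ Γ.into {z, w}, (Γ.rewire {z, w} j).inv d = j d := by
    intro d hd
    rw [hinv, if_pos]
    exact (Finset.mem_filter.1 hd).2.2
  have hS' : (Γ.rewire {z, w} j).IsAdm S' := by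
    constructor
    · intro d hd hdS
      simp only [rewire, Finset.mem_filter] at hd
      rcases hdS with ⟨h1, h2⟩ | ⟨h1, rfl | rfl⟩
      · rw [hinv, if_neg h2]
        refine Or.inl ⟨hS.inv_mem d hd.1 h1, ?_⟩
        rw [inv2 d hd.1]
        exact hd.2
      · rw [hinvB _ ((hinto _).2 (by simp)), j1]
        exact Or.inr ⟨h1, Or.inr rfl⟩
      · rw [hinvB _ ((hinto _).2 (by simp)), j2]
        exact Or.inr ⟨h1, Or.inl rfl⟩
    · intro v hv
      simp only [rewire, Finset.mem_sdiff] at hv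
      obtain ⟨d, hd, rfl, hdS⟩ := hS.exists_notMem v hv.1
      refine ⟨d, by simpa [rewire, hd] using hv.2, rfl, ?_⟩
      rintro (⟨h1, -⟩ | ⟨h1, rfl | rfl⟩)
      · exact hdS h1
      · exact hdS h1.1
      · exact hdS (hS.inv_mem _ hk h1.2.2)
  have hRvs : ({z, w} : Finset V) ⊆ Γ.vs := by
    intro v hv
    rcases (hR v).1 hv with rfl | rfl
    · exact vg ▸ hC.vert_mem g hg
    · exact vk ▸ hC.vert_mem k hk
  obtain ⟨M', c', hM', heM', hc'⟩ := hΓ.quells_rewire hj hcard hRvs ⟨z, by simp⟩ hS' he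
    (by rw [hR, ← hefv]; tauto)
  have hMinv : ∀ d ∈ Γ.into {z, w}, d ∈ M' → j d ∈ M' := by
    intro d hd hdM
    rw [← hinvB d hd]
    exact hM'.inv_mem d hdM
  have hfM : f ∉ M' := fun h' => hef (hM'.eq_of_vert_eq f h' e heM' hefv)
  have hkM : Γ.inv k ∉ M' := fun h' => hfM (j2 ▸ hMinv _ ((hinto _).2 (by simp)) h')
  have hSS' : ∀ d ∈ S, Γ.vert (Γ.inv d) ∉ ({z, w} : Finset V) → d ∈ S' :=
    fun d h1 h2 => Or.inl ⟨h1, h2⟩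
  have hzS := hz.not_all_mem hC hS
  have hwS := hw.not_all_mem hC hS
  rw [hsym f hf] at hzS
  rw [hsym g hg] at hwS
  obtain ⟨cx, hcx⟩ : ∃ q, c' (Γ.vert f) = q := ⟨_, rfl⟩
  obtain ⟨ck, hck⟩ : ∃ q, c' (Γ.vert (Γ.inv k)) = q := ⟨_, rfl⟩
  obtain ⟨ch, hch⟩ : ∃ q, c' (Γ.vert (Γ.inv h)) = q := ⟨_, rfl⟩
  obtain ⟨cl, hcl⟩ : ∃ q, c' (Γ.vert (Γ.inv l)) = q := ⟨_, rfl⟩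
  have hfc : f ∈ S → g ∈ S → k ∈ S → cx ≠ ck := by
    intro h1 h2 h3
    have := hc' f (by simp [rewire, hf, hxz, hxw]) (Or.inr ⟨⟨h1, h2, h3⟩, Or.inl rfl⟩) hfM
    rw [hinvB _ ((hinto _).2 (by simp)), j1] at this
    rw [← hcx, ← hck]
    exact this
  -- the conditions on the colours `a`, `b` of `z`, `w`
  have key : ∀ (a b : Bool) (X : Set D), (∀ v ∈ ({z, w} : Finset V), ∃ d ∈ X, Γ.vert d = v) →
      (∀ d ∈ X, d ∈ Γ.ds ∧ Γ.vert d ∈ ({z, w} : Finset V)) →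
      (∀ d ∈ X, Γ.vert (Γ.inv d) ∈ ({z, w} : Finset V) → Γ.inv d ∈ X) →
      (∀ d ∈ X, Γ.vert (Γ.inv d) ∉ ({z, w} : Finset V) → Γ.inv d ∈ M') →
      (∀ d ∈ M', d ∈ Γ.into {z, w} → Γ.inv d ∈ X) →
      (∀ d ∈ X, ∀ d' ∈ X, Γ.vert d = Γ.vert d' → d = d') →
      (f ∈ S → a ≠ cx) → (g ∈ S → g ∉ X → a ≠ b) → (h ∈ S → h ∉ X → a ≠ ch) →
      (k ∈ S → b ≠ ck) → (l ∈ S → l ∉ X → b ≠ cl) → Γ.Quells S e := by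
    intro a b X x1 x2 x3 x4 x5 x6 y1 y2 y3 y4 y5
    refine Quells.lift (c := fun v => if v = z then a else if v = w then b else c' v)
      hC hS hM' heM' hc' hSS' x2 x3 x4 x5 x1 x6 ?_ ?_
    · intro v hv
      rw [hR, not_or] at hv
      simp [hv.1, hv.2]
    · intro d hd hdR hdS hdX
      rcases (hR _).1 hdR with hv | hv
      · rcases hzcov d hd hv with rfl | rfl | rfl
        · simp only [hzdef, if', if_true, hxz, hxw, if_false, hcx]
          exact y1 ((hsym f hf).1 hdS)
        · simp only [vg, hwdef, if_true, hzw.symm, if_false]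
          exact y2 hdS hdX
        · simp only [vh, hhz, hhw, if_true, if_false, hch]
          exact y3 hdS hdX
      · rcases hwcov d hd hv with rfl | rfl | rfl
        · simp only [hwdef, vig, if_true, hzw.symm, if_false]
          refine (y2 ((hsym g hg).1 hdS) fun h' => hdX (x3 g h' ?_)).symm
          simp [hwdef]
        · simp only [vk, hkz, hkw, hzw.symm, if_true, if_false, hck]
          exact y4 hdS
        · simp only [vl, hlz, hlw, hzw.symm, if_true, if_false, hcl]
          exact y5 hdS hdX
  by_cases hm : Γ.inv h ∈ M'
  · have hlM : Γ.inv l ∈ M' := j3 ▸ hMinv _ ((hinto _).2 (by simp)) hm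
    obtain ⟨a, b, hab1, hab2, hab3⟩ := exists_two_colors cx ck (f ∈ S) (g ∈ S) (k ∈ S) hfc
    refine key a b {h, l} ?_ ?_ ?_ ?_ ?_ ?_ hab1 (fun h1 _ => hab2 h1) (by simp) hab3 (by simp)
    · intro v hv
      rcases (hR v).1 hv with rfl | rfl
      · exact ⟨h, by simp, vh⟩
      · exact ⟨l, by simp, vl⟩
    · rintro d (rfl | rfl)
      · exact ⟨hh, by simp [vh]⟩
      · exact ⟨hl, by simp [vl]⟩
    · rintro d (rfl | rfl) hd
      · simp [hhz, hhw] at hd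
      · simp [hlz, hlw] at hd
    · rintro d (rfl | rfl) hd <;> assumption
    · intro d hdM hd
      rcases (hinto d).1 hd with rfl | rfl | rfl | rfl
      · exact absurd hdM hfM
      · exact absurd hdM hkM
      · simp [ih]
      · simp [il]
    · rintro d (rfl | rfl) d' (rfl | rfl) hd
      · rfl
      · exact absurd (vh.symm.trans (hd.trans vl)) hzw
      · exact absurd (vh.symm.trans (hd.symm.trans vl)) hzw
      · rfl
  · have hlM : Γ.inv l ∉ M' := fun h' => hm (j4 ▸ hMinv _ ((hinto _).2 (by simp)) h')
    have hfh : ¬ (f ∈ S ∧ h ∈ S) := by tauto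
    have hkl : ¬ (k ∈ S ∧ l ∈ S) := by tauto
    refine key (if f ∈ S then !cx else !ch) (if k ∈ S then !ck else !cl) {g, Γ.inv g}
      ?_ ?_ ?_ ?_ ?_ ?_ ?_ (by simp) ?_ ?_ ?_
    · intro v hv
      rcases (hR v).1 hv with rfl | rfl
      · exact ⟨g, by simp, vg⟩
      · exact ⟨Γ.inv g, by simp, hwdef⟩
    · rintro d (rfl | rfl)
      · exact ⟨hg, by simp [vg]⟩
      · exact ⟨invm g hg, by simp [hwdef]⟩
    · rintro d (rfl | rfl) _
      · simp
      · simp [ig]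
    · rintro d (rfl | rfl) hd
      · simp [hwdef] at hd
      · simp [ig, vg] at hd
    · intro d hdM hd
      rcases (hinto d).1 hd with rfl | rfl | rfl | rfl <;> contradiction
    · rintro d (rfl | rfl) d' (rfl | rfl) hd
      · rfl
      · exact absurd (vg.symm.trans (hd.trans hwdef)) hzw
      · exact absurd (vg.symm.trans (hd.symm.trans hwdef)) hzw
      · rfl
    · intro h1
      simp [h1]
    · intro h1 _
      have : f ∉ S := fun h' => hfh ⟨h', h1⟩
      simp [this]
    · intro h1
      simp [h1]
    · intro h1 _
      have : k ∉ S := fun h' => hkl ⟨h', h1⟩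
      simp [this]

lemma exists_three_swaps {a b c d e f : D} (h : [a, b, c, d, e, f].Nodup) :
    ∃ j : D → D, j a = b ∧ j b = a ∧ j c = d ∧ j d = c ∧ j e = f ∧ j f = e := by
  classical
  simp only [List.nodup_cons, List.mem_cons, List.not_mem_nil, or_false, not_or] at h
  obtain ⟨⟨h1, h2, h3, h4, h5⟩, ⟨h6, h7, h8, h9⟩, ⟨h10, h11, h12⟩, ⟨h13, h14⟩, h15, -⟩ := h
  refine ⟨fun x => if x = a then b else if x = b then a else if x = c then d else
    if x = d then c else if x = e then f else e, ?_⟩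
  simp [Ne.symm h1, Ne.symm h2, Ne.symm h3, Ne.symm h4, Ne.symm h5, Ne.symm h6, Ne.symm h7,
    Ne.symm h8, Ne.symm h9, Ne.symm h10, Ne.symm h11, Ne.symm h12, Ne.symm h13, Ne.symm h14,
    Ne.symm h15]

set_option maxHeartbeats 4000000 in
lemma IsMinimal.quells_of_path {Γ : DartGraph V D} (hΓ : Γ.IsMinimal) {S : Set D}
    (hS : Γ.IsAdm S) {e f g h k l p α γ β : D} (he : e ∈ Γ.ds) (hf : f ∈ Γ.ds) (hef : f ≠ e)
    (hefv : Γ.vert f = Γ.vert e) (hz : Γ.IsStar (Γ.inv f) g h) (hw : Γ.IsStar (Γ.inv g) k l)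
    (hu : Γ.IsStar (Γ.inv k) p α) (ht : Γ.IsStar (Γ.inv p) γ β)
    (hkS : k ∈ S) (hlS : l ∈ S) (hpS : p ∈ S) (hγS : γ ∈ S)
    (hfree : ∀ d ∈ Γ.ds, Γ.vert d = Γ.vert f → ∀ d' ∈ Γ.ds,
      Γ.vert d' = Γ.vert d ∨ Γ.vert d' = Γ.vert (Γ.inv d) → d' ∉ S) : Γ.Quells S e := by
  classical
  have hC := hΓ.isCubic
  have inv2 := hC.inv_inv
  have invm := hC.inv_mem
  have loop : ∀ {d : D}, d ∈ Γ.ds → Γ.vert (Γ.inv d) ≠ Γ.vert d := fun hd => vert_inv_ne hC hd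
  have par : ∀ {d d' : D}, d ∈ Γ.ds → d' ∈ Γ.ds → Γ.vert d = Γ.vert d' →
      Γ.vert (Γ.inv d) = Γ.vert (Γ.inv d') → d = d' :=
    fun h1 h2 => hΓ.noSmallCut.eq_of_parallel hC hΓ.six_le h1 h2
  have tri : ∀ {a b c : D}, a ∈ Γ.ds → b ∈ Γ.ds → c ∈ Γ.ds → Γ.vert (Γ.inv a) = Γ.vert b →
      Γ.vert (Γ.inv b) = Γ.vert c → Γ.vert (Γ.inv c) = Γ.vert a → False :=
    fun h1 h2 h3 => hΓ.noSmallCut.no_triangle hC hΓ.six_le h1 h2 h3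
  have hsym : ∀ d ∈ Γ.ds, (Γ.inv d ∈ S ↔ d ∈ S) := fun d hd =>
    ⟨fun h' => by rw [← inv2 d hd]; exact hS.inv_mem _ (invm d hd) h', hS.inv_mem d hd⟩
  have hg := hz.mem_mid
  have hh := hz.mem_right
  have hk := hw.mem_mid
  have hl := hw.mem_right
  have hp := hu.mem_mid
  have hα := hu.mem_right
  have hγ := ht.mem_mid
  have hβ := ht.mem_right
  have vg := hz.vert_mid
  have vh := hz.vert_right
  have vk := hw.vert_mid
  have vl := hw.vert_right
  have vp := hu.vert_mid
  have vα := hu.vert_right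
  have vγ := ht.vert_mid
  have vβ := ht.vert_right
  have zcov := hz.cover
  have wcov := hw.cover
  have ucov := hu.cover
  have tcov := ht.cover
  obtain ⟨z, vif⟩ : ∃ z, Γ.vert (Γ.inv f) = z := ⟨_, rfl⟩
  obtain ⟨w, vig⟩ : ∃ w, Γ.vert (Γ.inv g) = w := ⟨_, rfl⟩
  obtain ⟨u, vik⟩ : ∃ u, Γ.vert (Γ.inv k) = u := ⟨_, rfl⟩
  obtain ⟨t, vip⟩ : ∃ t, Γ.vert (Γ.inv p) = t := ⟨_, rfl⟩
  rw [vif] at vg vh zcov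
  rw [vig] at vk vl wcov
  rw [vik] at vp vα ucov
  rw [vip] at vγ vβ tcov
  have iF := inv2 f hf
  have ig := inv2 g hg
  have ih := inv2 h hh
  have ik := inv2 k hk
  have il := inv2 l hl
  have ip := inv2 p hp
  have iα := inv2 α hα
  have iγ := inv2 γ hγ
  have iβ := inv2 β hβ
  have vvg : Γ.vert (Γ.inv (Γ.inv g)) = z := by rw [ig, vg]
  have vvh : Γ.vert (Γ.inv (Γ.inv h)) = z := by rw [ih, vh]
  have vvk : Γ.vert (Γ.inv (Γ.inv k)) = w := by rw [ik, vk]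
  have vvl : Γ.vert (Γ.inv (Γ.inv l)) = w := by rw [il, vl]
  have vvp : Γ.vert (Γ.inv (Γ.inv p)) = u := by rw [ip, vp]
  have vvα : Γ.vert (Γ.inv (Γ.inv α)) = u := by rw [iα, vα]
  have vvβ : Γ.vert (Γ.inv (Γ.inv β)) = t := by rw [iβ, vβ]
  have vvγ : Γ.vert (Γ.inv (Γ.inv γ)) = t := by rw [iγ, vγ]
  have ikS := hS.inv_mem k hk hkS
  have ilS := hS.inv_mem l hl hlS
  have ipS := hS.inv_mem p hp hpS
  have iγS := hS.inv_mem γ hγ hγS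
  have hαS : α ∉ S := fun h' => hu.not_all_mem hC hS ⟨ikS, hpS, h'⟩
  have hβS : β ∉ S := fun h' => ht.not_all_mem hC hS ⟨ipS, hγS, h'⟩
  have freex : ∀ d ∈ S, d ∈ Γ.ds → Γ.vert d ≠ Γ.vert f :=
    fun d hdS hd hv => hfree f hf rfl d hd (Or.inl hv) hdS
  have freez : ∀ d ∈ S, d ∈ Γ.ds → Γ.vert d ≠ z :=
    fun d hdS hd hv => hfree f hf rfl d hd (Or.inr (hv.trans vif.symm)) hdS
  have hhS : h ∉ S := fun h' => freez h h' hh vh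
  have hgS : g ∉ S := fun h' => freez g h' hg vg
  have hzw : z ≠ w := by rw [← vg, ← vig]; exact (loop hg).symm
  have hwu : w ≠ u := by rw [← vk, ← vik]; exact (loop hk).symm
  have hut : u ≠ t := by rw [← vp, ← vip]; exact (loop hp).symm
  have hzu : z ≠ u := by rw [← vik]; exact (freez _ ikS (invm k hk)).symm
  have hzt : z ≠ t := by rw [← vip]; exact (freez _ ipS (invm p hp)).symm
  have hwt : w ≠ t := fun h' => hu.mid_ne_left <| by
    rw [par hk (invm p hp) (vk.trans (h'.trans vip.symm)) (vik.trans vvp.symm), ip]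
  have hR : ∀ v, v ∈ ({z, w, u, t} : Finset V) ↔ v = z ∨ v = w ∨ v = u ∨ v = t := by simp
  have zR : z ∈ ({z, w, u, t} : Finset V) := by simp
  have wR : w ∈ ({z, w, u, t} : Finset V) := by simp
  have uR : u ∈ ({z, w, u, t} : Finset V) := by simp
  have tR : t ∈ ({z, w, u, t} : Finset V) := by simp
  have out : ∀ {v : V}, v ≠ z → v ≠ w → v ≠ u → v ≠ t → v ∉ ({z, w, u, t} : Finset V) := by
    intro v h1 h2 h3 h4
    simp [h1, h2, h3, h4]
  have outf : Γ.vert f ∉ ({z, w, u, t} : Finset V) := by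
    refine out ?_ ?_ ?_ ?_
    · rw [← vif]; exact (loop hf).symm
    · rw [← vk]; exact (freex k hkS hk).symm
    · rw [← vp]; exact (freex p hpS hp).symm
    · rw [← vγ]; exact (freex γ hγS hγ).symm
  have outl : Γ.vert (Γ.inv l) ∉ ({z, w, u, t} : Finset V) := by
    refine out (freez _ ilS (invm l hl)) ?_ ?_ ?_
    · rw [← vl]; exact loop hl
    · exact fun h' => hw.mid_ne_right (par hk hl (vk.trans vl.symm) (vik.trans h'.symm))
    · exact fun h' => tri hk hp (invm l hl) (vik.trans vp.symm) (vip.trans h'.symm)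
        (vvl.trans vk.symm)
  have outα : Γ.vert (Γ.inv α) ∉ ({z, w, u, t} : Finset V) := by
    refine out ?_ ?_ ?_ ?_
    · exact fun h' => tri hg hk hα (vig.trans vk.symm) (vik.trans vα.symm) (h'.trans vg.symm)
    · exact fun h' => hu.right_ne_left
        (par hα (invm k hk) (vα.trans vik.symm) (h'.trans vvk.symm))
    · rw [← vα]; exact loop hα
    · exact fun h' => hu.mid_ne_right (par hp hα (vp.trans vα.symm) (vip.trans h'.symm))
  have outγ : Γ.vert (Γ.inv γ) ∉ ({z, w, u, t} : Finset V) := by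
    refine out (freez _ iγS (invm γ hγ)) ?_ ?_ ?_
    · exact fun h' => tri hk hp hγ (vik.trans vp.symm) (vip.trans vγ.symm) (h'.trans vk.symm)
    · exact fun h' => ht.mid_ne_left
        (par hγ (invm p hp) (vγ.trans vip.symm) (h'.trans vvp.symm))
    · rw [← vγ]; exact loop hγ
  have hαγ : Γ.vert (Γ.inv α) ≠ Γ.vert (Γ.inv γ) := fun h' =>
    tri hp hγ (invm α hα) (vip.trans vγ.symm) h'.symm (vvα.trans vp.symm)
  have hinto : ∀ d, d ∈ Γ.into {z, w, u, t} ↔ d ∈ Γ.ds ∧ Γ.vert d ∉ ({z, w, u, t} : Finset V) ∧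
      Γ.vert (Γ.inv d) ∈ ({z, w, u, t} : Finset V) := by
    intro d
    simp only [into, Finset.mem_filter]
  have into_cases : ∀ d ∈ Γ.into {z, w, u, t}, d = f ∨ d = Γ.inv β ∨ d = Γ.inv h ∨ d = Γ.inv l ∨
      d = Γ.inv α ∨ d = Γ.inv γ := by
    intro d hd
    obtain ⟨hd, h1, h2⟩ := (hinto d).1 hd
    have h3 := inv2 d hd
    have h4 := invm d hd
    rcases (hR _).1 h2 with h5 | h5 | h5 | h5
    · rcases zcov _ h4 h5 with h6 | h6 | h6 <;> rw [h6] at h3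
      · exact Or.inl (h3.symm.trans iF)
      · exact absurd (h3 ▸ vig ▸ wR) h1
      · simp [h3]
    · rcases wcov _ h4 h5 with h6 | h6 | h6 <;> rw [h6] at h3
      · exact absurd (h3 ▸ vvg ▸ zR) h1
      · exact absurd (h3 ▸ vik ▸ uR) h1
      · simp [h3]
    · rcases ucov _ h4 h5 with h6 | h6 | h6 <;> rw [h6] at h3
      · exact absurd (h3 ▸ vvk ▸ wR) h1
      · exact absurd (h3 ▸ vip ▸ tR) h1
      · simp [h3]
    · rcases tcov _ h4 h5 with h6 | h6 | h6 <;> rw [h6] at h3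
      · exact absurd (h3 ▸ vvp ▸ uR) h1
      · simp [h3]
      · simp [h3]
  have finto : f ∈ Γ.into {z, w, u, t} := (hinto f).2 ⟨hf, outf, vif ▸ zR⟩
  have linto : Γ.inv l ∈ Γ.into {z, w, u, t} := (hinto _).2 ⟨invm l hl, outl, vvl ▸ wR⟩
  have αinto : Γ.inv α ∈ Γ.into {z, w, u, t} := (hinto _).2 ⟨invm α hα, outα, vvα ▸ uR⟩
  have γinto : Γ.inv γ ∈ Γ.into {z, w, u, t} := (hinto _).2 ⟨invm γ hγ, outγ, vvγ ▸ tR⟩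
  have hcard : (Γ.into {z, w, u, t}).card ≤ 6 := by
    have : Γ.into {z, w, u, t} ⊆ {f, Γ.inv β, Γ.inv h, Γ.inv l, Γ.inv α, Γ.inv γ} := by
      intro d hd
      simpa using into_cases d hd
    exact (Finset.card_le_card this).trans Finset.card_le_six
  set S' : Set D := {d | d ∈ S ∧ Γ.vert (Γ.inv d) ∉ ({z, w, u, t} : Finset V)} with hS'def
  have hinv : ∀ j d, (Γ.rewire {z, w, u, t} j).inv d =
    if Γ.vert (Γ.inv d) ∈ ({z, w, u, t} : Finset V) then j d else Γ.inv d := fun _ _ => rfl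
  have hS' : ∀ j, (Γ.rewire {z, w, u, t} j).IsAdm S' := by
    intro j
    constructor
    · rintro d hd ⟨h1, h2⟩
      simp only [rewire, Finset.mem_filter] at hd
      rw [hinv, if_neg h2]
      refine ⟨hS.inv_mem d hd.1 h1, ?_⟩
      rw [inv2 d hd.1]
      exact hd.2
    · intro v hv
      simp only [rewire, Finset.mem_sdiff] at hv
      obtain ⟨d, hd, rfl, hdS⟩ := hS.exists_notMem v hv.1
      exact ⟨d, by simpa [rewire, hd] using hv.2, rfl, fun h' => hdS h'.1⟩
  have hRvs : ({z, w, u, t} : Finset V) ⊆ Γ.vs := by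
    intro v hv
    rcases (hR v).1 hv with rfl | rfl | rfl | rfl
    · exact vg ▸ hC.vert_mem g hg
    · exact vk ▸ hC.vert_mem k hk
    · exact vp ▸ hC.vert_mem p hp
    · exact vγ ▸ hC.vert_mem γ hγ
  have key : ∀ (j : D → D) (M' : Set D) (c' : V → Bool) (dz dw du dt : D) (a b c : Bool),
      (Γ.rewire {z, w, u, t} j).IsPM M' → e ∈ M' →
      (∀ d ∈ (Γ.rewire {z, w, u, t} j).ds, d ∈ S' → d ∉ M' →
        c' ((Γ.rewire {z, w, u, t} j).vert d) ≠
          c' ((Γ.rewire {z, w, u, t} j).vert ((Γ.rewire {z, w, u, t} j).inv d))) →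
      (dz ∈ Γ.ds ∧ dw ∈ Γ.ds ∧ du ∈ Γ.ds ∧ dt ∈ Γ.ds) →
      Γ.vert dz = z → Γ.vert dw = w → Γ.vert du = u → Γ.vert dt = t →
      (∀ d ∈ ({dz, dw, du, dt} : Set D), Γ.inv d ∈ ({dz, dw, du, dt} : Set D) ∨ Γ.inv d ∈ M') →
      (∀ d ∈ M', d ∈ Γ.into {z, w, u, t} → Γ.inv d ∈ ({dz, dw, du, dt} : Set D)) →
      (k ∉ ({dz, dw, du, dt} : Set D) → a ≠ b) →
      (l ∉ ({dz, dw, du, dt} : Set D) → a ≠ c' (Γ.vert (Γ.inv l))) →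
      (p ∉ ({dz, dw, du, dt} : Set D) → b ≠ c) →
      (γ ∉ ({dz, dw, du, dt} : Set D) → c ≠ c' (Γ.vert (Γ.inv γ))) → Γ.Quells S e := by
    intro j M' c' dz dw du dt a b c hM' heM' hc' hds x1 x2 x3 x4 x5 x6 y1 y2 y3 y4
    set X : Set D := {dz, dw, du, dt} with hXdef
    have hXR : ∀ d ∈ X, Γ.vert d ∈ ({z, w, u, t} : Finset V) := by
      rintro d (rfl | rfl | rfl | rfl)
      · exact x1 ▸ zR
      · exact x2 ▸ wR
      · exact x3 ▸ uR
      · exact x4 ▸ tR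
    have hM'R : ∀ d ∈ M', Γ.vert d ∉ ({z, w, u, t} : Finset V) := by
      intro d hd
      have := hM'.mem_ds d hd
      simp only [rewire, Finset.mem_filter] at this
      exact this.2
    have hXinv : ∀ d ∈ X, Γ.vert (Γ.inv d) ∈ ({z, w, u, t} : Finset V) → Γ.inv d ∈ X :=
      fun d hd hv => (x5 d hd).resolve_right fun h' => hM'R _ h' hv
    refine Quells.lift (c := fun v => if v = w then a else if v = u then b else
      if v = t then c else c' v) (X := X) hC hS hM' heM' hc' (fun d h1 h2 => ⟨h1, h2⟩) ?_ hXinv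
      (fun d hd hv => (x5 d hd).resolve_left fun h' => hv (hXR _ h')) x6 ?_ ?_ ?_ ?_
    · intro d hd
      refine ⟨?_, hXR d hd⟩
      rcases hd with rfl | rfl | rfl | rfl <;> tauto
    · intro v hv
      rcases (hR v).1 hv with rfl | rfl | rfl | rfl
      · exact ⟨dz, by simp [hXdef], x1⟩
      · exact ⟨dw, by simp [hXdef], x2⟩
      · exact ⟨du, by simp [hXdef], x3⟩
      · exact ⟨dt, by simp [hXdef], x4⟩
    · rintro d (rfl | rfl | rfl | rfl) d' (rfl | rfl | rfl | rfl) hd <;>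
        simp only [x1, x2, x3, x4, hzw, hzu, hzt, hwu, hwt, hut, hzw.symm, hzu.symm, hzt.symm,
          hwu.symm, hwt.symm, hut.symm] at hd <;> rfl
    · intro v hv
      rw [hR, not_or, not_or, not_or] at hv
      simp [hv.2.1, hv.2.2.1, hv.2.2.2]
    · intro d hd hdR hdS hdX
      have cl : (if Γ.vert (Γ.inv l) = w then a else if Γ.vert (Γ.inv l) = u then b else
          if Γ.vert (Γ.inv l) = t then c else c' (Γ.vert (Γ.inv l))) = c' (Γ.vert (Γ.inv l)) := by
        rw [hR, not_or, not_or, not_or] at outl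
        simp [outl.2.1, outl.2.2.1, outl.2.2.2]
      have cγ : (if Γ.vert (Γ.inv γ) = w then a else if Γ.vert (Γ.inv γ) = u then b else
          if Γ.vert (Γ.inv γ) = t then c else c' (Γ.vert (Γ.inv γ))) = c' (Γ.vert (Γ.inv γ)) := by
        rw [hR, not_or, not_or, not_or] at outγ
        simp [outγ.2.1, outγ.2.2.1, outγ.2.2.2]
      rcases (hR _).1 hdR with hv | hv | hv | hv
      · exact absurd hv (freez d hdS hd)
      · rcases wcov d hd hv with rfl | rfl | rfl
        · exact absurd ((hsym g hg).1 hdS) hgS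
        · simp only [vk, vik, hwu.symm, if_true, if_false]
          exact y1 hdX
        · simp only [cl, vl, if_true]
          exact y2 hdX
      · rcases ucov d hd hv with rfl | rfl | rfl
        · simp only [vik, vvk, hwu.symm, if_true, if_false]
          exact (y1 fun h' => hdX (hXinv k h' (vik ▸ uR))).symm
        · simp only [vp, vip, hwu.symm, hwt.symm, hut.symm, if_true, if_false]
          exact y3 hdX
        · exact absurd hdS hαS
      · rcases tcov d hd hv with rfl | rfl | rfl
        · simp only [vip, vvp, hwu.symm, hwt.symm, hut.symm, if_true, if_false]
          exact (y3 fun h' => hdX (hXinv p h' (vip ▸ tR))).symm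
        · simp only [cγ]
          simp only [vγ, hwt.symm, hut.symm, if_true, if_false]
          exact y4 hdX
        · exact absurd hdS hβS
  have nev : ∀ a b : D, Γ.vert a ≠ Γ.vert b → a ≠ b := fun a b h' h'' => h' (by rw [h''])
  have inj : ∀ a ∈ Γ.ds, ∀ b ∈ Γ.ds, Γ.inv a = Γ.inv b → a = b := fun a ha b hb h' => by
    rw [← inv2 a ha, h', inv2 b hb]
  have hMj : ∀ j M', (Γ.rewire {z, w, u, t} j).IsPM M' →
      ∀ d ∈ Γ.into {z, w, u, t}, d ∈ M' → j d ∈ M' := by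
    intro j M' hM' d hd hdM
    have := hM'.inv_mem d hdM
    rwa [hinv, if_pos ((hinto d).1 hd).2.2] at this
  have heR : Γ.vert e ∉ ({z, w, u, t} : Finset V) := hefv ▸ outf
  by_cases hβh : Γ.inv h = β
  · have hhβ : Γ.inv β = h := by rw [← hβh, ih]
    have into_cases' : ∀ d ∈ Γ.into {z, w, u, t}, d = f ∨ d = Γ.inv l ∨
        d = Γ.inv α ∨ d = Γ.inv γ := by
      intro d hd
      have hd' := ((hinto d).1 hd).2.1
      rcases into_cases d hd with rfl | rfl | rfl | rfl | rfl | rfl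
      · simp
      · exact absurd (hhβ ▸ vh ▸ zR) hd'
      · exact absurd (hβh ▸ vβ ▸ tR) hd'
      · simp
      · simp
      · simp
    have hfl : Γ.vert f ≠ Γ.vert (Γ.inv l) := (freex _ ilS (invm l hl)).symm
    obtain ⟨j, j1, j2, j3, j4⟩ := exists_two_swaps (a := f) (b := Γ.inv l) (c := Γ.inv α)
      (d := Γ.inv γ) (nev _ _ hfl) (fun h' => hzu (by rw [← vif, h', vvα]))
      (fun h' => hzt (by rw [← vif, h', vvγ])) (fun h' => hwu (by rw [← vvl, h', vvα]))
      (fun h' => hwt (by rw [← vvl, h', vvγ])) (nev _ _ hαγ)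
    have hj : ∀ d ∈ Γ.into {z, w, u, t}, j d ∈ Γ.into {z, w, u, t} ∧ j (j d) = d ∧
        Γ.vert (j d) ≠ Γ.vert d := by
      intro d hd
      rcases into_cases' d hd with rfl | rfl | rfl | rfl
      · rw [j1, j2]; exact ⟨linto, rfl, hfl.symm⟩
      · rw [j2, j1]; exact ⟨finto, rfl, hfl⟩
      · rw [j3, j4]; exact ⟨γinto, rfl, hαγ.symm⟩
      · rw [j4, j3]; exact ⟨αinto, rfl, hαγ⟩
    obtain ⟨M', c', hM', heM', hc'⟩ := hΓ.quells_rewire hj hcard hRvs ⟨z, zR⟩ (hS' j) he heR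
    have hfM : f ∉ M' := fun h' => hef (hM'.eq_of_vert_eq f h' e heM' hefv)
    have hlM : Γ.inv l ∉ M' := fun h' => hfM (j2 ▸ hMj j M' hM' _ linto h')
    by_cases hm : Γ.inv α ∈ M'
    · have hγM : Γ.inv γ ∈ M' := j3 ▸ hMj j M' hM' _ αinto hm
      refine key j M' c' g (Γ.inv g) α γ (!c' (Γ.vert (Γ.inv l))) (c' (Γ.vert (Γ.inv l)))
        (!c' (Γ.vert (Γ.inv l))) hM' heM' hc' ⟨hg, invm g hg, hα, hγ⟩ vg vig vα vγ ?_ ?_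
        (by simp) (by simp) (by simp) (by simp)
      · rintro d (rfl | rfl | rfl | rfl)
        · simp
        · simp [ig]
        · exact Or.inr hm
        · exact Or.inr hγM
      · intro d hdM hd
        rcases into_cases' d hd with rfl | rfl | rfl | rfl
        · contradiction
        · contradiction
        · simp [iα]
        · simp [iγ]
    · have hγM : Γ.inv γ ∉ M' := fun h' => hm (j4 ▸ hMj j M' hM' _ γinto h')
      refine key j M' c' h k (Γ.inv k) β (!c' (Γ.vert (Γ.inv l))) (c' (Γ.vert (Γ.inv γ)))
        (!c' (Γ.vert (Γ.inv γ))) hM' heM' hc' ⟨hh, hk, invm k hk, hβ⟩ vh vk vik vβ ?_ ?_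
        (by simp) (by simp) (by simp) (by simp)
      · rintro d (rfl | rfl | rfl | rfl)
        · simp [hβh]
        · simp
        · simp [ik]
        · simp [hhβ]
      · intro d hdM hd
        rcases into_cases' d hd with rfl | rfl | rfl | rfl <;> contradiction
  · have outh : Γ.vert (Γ.inv h) ∉ ({z, w, u, t} : Finset V) := by
      refine out ?_ ?_ ?_ ?_
      · rw [← vh]; exact loop hh
      · exact fun h' => hz.mid_ne_right (par hg hh (vg.trans vh.symm) (vig.trans h'.symm))
      · exact fun h' => tri hg hk (invm h hh) (vig.trans vk.symm) (vik.trans h'.symm)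
          (vvh.trans vg.symm)
      · intro h'
        have hih : Γ.inv h ∉ S := fun h'' => hhS ((hsym h hh).1 h'')
        rcases tcov _ (invm h hh) h' with h'' | h'' | h''
        · exact hih (h'' ▸ ipS)
        · exact hih (h'' ▸ hγS)
        · exact hβh h''
    have outβ : Γ.vert (Γ.inv β) ∉ ({z, w, u, t} : Finset V) := by
      refine out ?_ ?_ ?_ ?_
      · intro h'
        rcases zcov _ (invm β hβ) h' with h'' | h'' | h'' <;> have h3 := iβ <;> rw [h''] at h3
        · exact outf (by rw [← iF, h3, vβ]; exact tR)
        · exact hwt (by rw [← vig, h3, vβ])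
        · exact hβh h3
      · exact fun h' => tri hk hp hβ (vik.trans vp.symm) (vip.trans vβ.symm) (h'.trans vk.symm)
      · exact fun h' => ht.right_ne_left
          (par hβ (invm p hp) (vβ.trans vip.symm) (h'.trans vvp.symm))
      · rw [← vβ]; exact loop hβ
    have hinto' : Γ.inv h ∈ Γ.into {z, w, u, t} := (hinto _).2 ⟨invm h hh, outh, vvh ▸ zR⟩
    have βinto : Γ.inv β ∈ Γ.into {z, w, u, t} := (hinto _).2 ⟨invm β hβ, outβ, vvβ ▸ tR⟩
    have hfβ : Γ.vert f ≠ Γ.vert (Γ.inv β) := fun h' =>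
      hfree _ (invm β hβ) h'.symm γ hγ (Or.inr (vγ.trans vvβ.symm)) hγS
    have hhl : Γ.vert (Γ.inv h) ≠ Γ.vert (Γ.inv l) := fun h' =>
      tri hg hl (invm h hh) (vig.trans vl.symm) h'.symm (vvh.trans vg.symm)
    have nodup : [f, Γ.inv β, Γ.inv h, Γ.inv l, Γ.inv α, Γ.inv γ].Nodup := by
      have h1 : [Γ.inv f, β, h, l, α, γ].Nodup := by
        have hn1 := hz.right_ne_left
        have hn2 := ht.mid_ne_right
        simp only [List.nodup_cons, List.mem_cons, List.not_mem_nil, or_false, not_or,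
          List.nodup_nil, not_false_eq_true, and_true]
        refine ⟨⟨?_, hn1.symm, ?_, ?_, ?_⟩, ⟨?_, ?_, ?_, hn2.symm⟩, ⟨?_, ?_, ?_⟩, ⟨?_, ?_⟩, ?_⟩ <;>
          apply nev <;> simp only [vif, vβ, vh, vl, vα, vγ] <;>
          first | assumption | exact Ne.symm ‹_›
      have h2 := List.Nodup.map_on (f := Γ.inv) (by
        intro a ha b hb h'
        refine inj a ?_ b ?_ h'
        · simp only [List.mem_cons, List.not_mem_nil, or_false] at ha
          rcases ha with rfl | rfl | rfl | rfl | rfl | rfl <;>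
            first | assumption | exact invm _ ‹_›
        · simp only [List.mem_cons, List.not_mem_nil, or_false] at hb
          rcases hb with rfl | rfl | rfl | rfl | rfl | rfl <;>
            first | assumption | exact invm _ ‹_›) h1
      simpa only [List.map_cons, List.map_nil, iF] using h2
    obtain ⟨j, j1, j2, j3, j4, j5, j6⟩ := exists_three_swaps nodup
    have hj : ∀ d ∈ Γ.into {z, w, u, t}, j d ∈ Γ.into {z, w, u, t} ∧ j (j d) = d ∧
        Γ.vert (j d) ≠ Γ.vert d := by
      intro d hd
      rcases into_cases d hd with rfl | rfl | rfl | rfl | rfl | rfl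
      · rw [j1, j2]; exact ⟨βinto, rfl, hfβ.symm⟩
      · rw [j2, j1]; exact ⟨finto, rfl, hfβ⟩
      · rw [j3, j4]; exact ⟨linto, rfl, hhl.symm⟩
      · rw [j4, j3]; exact ⟨hinto', rfl, hhl⟩
      · rw [j5, j6]; exact ⟨γinto, rfl, hαγ.symm⟩
      · rw [j6, j5]; exact ⟨αinto, rfl, hαγ⟩
    obtain ⟨M', c', hM', heM', hc'⟩ := hΓ.quells_rewire hj hcard hRvs ⟨z, zR⟩ (hS' j) he heR
    have hfM : f ∉ M' := fun h' => hef (hM'.eq_of_vert_eq f h' e heM' hefv)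
    have hβM : Γ.inv β ∉ M' := fun h' => hfM (j2 ▸ hMj j M' hM' _ βinto h')
    by_cases hm : Γ.inv h ∈ M'
    · have hlM : Γ.inv l ∈ M' := j3 ▸ hMj j M' hM' _ hinto' hm
      by_cases hm' : Γ.inv α ∈ M'
      · have hγM : Γ.inv γ ∈ M' := j5 ▸ hMj j M' hM' _ αinto hm'
        refine key j M' c' h l α γ (!c' (Γ.vert (Γ.inv l))) (c' (Γ.vert (Γ.inv l)))
          (!c' (Γ.vert (Γ.inv l))) hM' heM' hc' ⟨hh, hl, hα, hγ⟩ vh vl vα vγ ?_ ?_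
          (by simp) (by simp) (by simp) (by simp)
        · rintro d (rfl | rfl | rfl | rfl) <;> right <;> assumption
        · intro d hdM hd
          rcases into_cases d hd with rfl | rfl | rfl | rfl | rfl | rfl <;>
            first | contradiction | simp [ih, il, iα, iγ]
      · have hγM : Γ.inv γ ∉ M' := fun h' => hm' (j6 ▸ hMj j M' hM' _ γinto h')
        refine key j M' c' h l p (Γ.inv p) (!c' (Γ.vert (Γ.inv l))) (c' (Γ.vert (Γ.inv l)))
          (!c' (Γ.vert (Γ.inv γ))) hM' heM' hc' ⟨hh, hl, hp, invm p hp⟩ vh vl vp vip ?_ ?_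
          (by simp) (by simp) (by simp) (by simp)
        · rintro d (rfl | rfl | rfl | rfl)
          · exact Or.inr hm
          · exact Or.inr hlM
          · simp
          · simp [ip]
        · intro d hdM hd
          rcases into_cases d hd with rfl | rfl | rfl | rfl | rfl | rfl <;>
            first | contradiction | simp [ih, il]
    · have hlM : Γ.inv l ∉ M' := fun h' => hm (j4 ▸ hMj j M' hM' _ linto h')
      by_cases hm' : Γ.inv α ∈ M'
      · have hγM : Γ.inv γ ∈ M' := j5 ▸ hMj j M' hM' _ αinto hm'
        refine key j M' c' g (Γ.inv g) α γ (!c' (Γ.vert (Γ.inv l))) (c' (Γ.vert (Γ.inv l)))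
          (!c' (Γ.vert (Γ.inv l))) hM' heM' hc' ⟨hg, invm g hg, hα, hγ⟩ vg vig vα vγ ?_ ?_
          (by simp) (by simp) (by simp) (by simp)
        · rintro d (rfl | rfl | rfl | rfl)
          · simp
          · simp [ig]
          · exact Or.inr hm'
          · exact Or.inr hγM
        · intro d hdM hd
          rcases into_cases d hd with rfl | rfl | rfl | rfl | rfl | rfl <;>
            first | contradiction | simp [iα, iγ]
      · have hγM : Γ.inv γ ∉ M' := fun h' => hm' (j6 ▸ hMj j M' hM' _ γinto h')
        refine key j M' c' g (Γ.inv g) p (Γ.inv p) (!c' (Γ.vert (Γ.inv l)))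
          (c' (Γ.vert (Γ.inv l))) (!c' (Γ.vert (Γ.inv γ))) hM' heM' hc'
          ⟨hg, invm g hg, hp, invm p hp⟩ vg vig vp vip ?_ ?_
          (by simp) (by simp) (by simp) (by simp)
        · rintro d (rfl | rfl | rfl | rfl)
          · simp
          · simp [ig]
          · simp
          · simp [ip]
        · intro d hdM hd
          rcases into_cases d hd with rfl | rfl | rfl | rfl | rfl | rfl <;> contradiction

lemma IsTwoReg.exists_isStar {Γ : DartGraph V D} (hΓ : Γ.IsCubic) {S : Set D}
    (h2 : Γ.IsTwoReg S) {d : D} (hd : d ∈ Γ.ds) (hdS : d ∈ S) :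
    ∃ b c, Γ.IsStar d b c ∧ b ∈ S := by
  obtain ⟨b, c, hstar⟩ := DartGraph.exists_isStar hΓ hd
  obtain ⟨d', hd', hv, hne, hS'⟩ := h2 d hd hdS
  rcases hstar.cover d' hd' hv with rfl | rfl | rfl
  · exact absurd rfl hne
  · exact ⟨_, _, hstar, hS'⟩
  · exact ⟨_, _, hstar.swap, hS'⟩

lemma Quells.of_inv {Γ : DartGraph V D} {S : Set D} {e : D} (hinv : Γ.inv (Γ.inv e) = e)
    (h : Γ.Quells S (Γ.inv e)) : Γ.Quells S e := by
  obtain ⟨M, c, hM, heM, hc⟩ := h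
  exact ⟨M, c, hM, hinv ▸ hM.inv_mem _ heM, hc⟩

lemma IsMinimal.quells_of_neighbor {Γ : DartGraph V D} (hΓ : Γ.IsMinimal) {S : Set D}
    (hS : Γ.IsAdm S) (h2 : Γ.IsTwoReg S) {e f d : D} (he : e ∈ Γ.ds) (hf : f ∈ Γ.ds)
    (hef : f ≠ e) (hefv : Γ.vert f = Γ.vert e) (hd : d ∈ Γ.ds) (hdS : d ∈ S)
    (hdv : Γ.vert d = Γ.vert (Γ.inv f)) : Γ.Quells S e := by
  have hC := hΓ.isCubic
  obtain ⟨g, hg, hgS, hgv, hgf⟩ :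
      ∃ g ∈ Γ.ds, g ∈ S ∧ Γ.vert g = Γ.vert (Γ.inv f) ∧ g ≠ Γ.inv f := by
    by_cases h : d = Γ.inv f
    · obtain ⟨d', hd', hv, hne, hS'⟩ := h2 d hd hdS
      exact ⟨d', hd', hS', hv.trans hdv, h ▸ hne⟩
    · exact ⟨d, hd, hdS, hdv, h⟩
  obtain ⟨h, hz⟩ : ∃ h, Γ.IsStar (Γ.inv f) g h := by
    obtain ⟨a, b, hstar⟩ := exists_isStar hC (hC.inv_mem f hf)
    rcases hstar.cover g hg hgv with rfl | rfl | rfl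
    · exact absurd rfl hgf
    · exact ⟨_, hstar⟩
    · exact ⟨_, hstar.swap⟩
  obtain ⟨k, l, hw⟩ := exists_isStar hC (hC.inv_mem g hg)
  exact hΓ.quells_of_edge hS he hf hef hefv hz hw fun h => absurd hgS h

lemma IsMinimal.quells_of_isTwoReg {Γ : DartGraph V D} (hΓ : Γ.IsMinimal) {S : Set D}
    (hS : Γ.IsAdm S) (h2 : Γ.IsTwoReg S) {e : D} (he : e ∈ Γ.ds) (heS : e ∉ S) :
    Γ.Quells S e := by
  have hC := hΓ.isCubic
  have hsym : ∀ d ∈ Γ.ds, Γ.inv d ∈ S → d ∈ S := fun d hd h' => by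
    rw [← hC.inv_inv d hd]; exact hS.inv_mem _ (hC.inv_mem d hd) h'
  by_contra hQ
  have hside : ∀ f ∈ Γ.ds, f ≠ e → Γ.vert f = Γ.vert e → ∀ d ∈ Γ.ds,
      Γ.vert d = Γ.vert (Γ.inv f) → d ∉ S := fun f hf hef hv d hd hdv hdS =>
    hQ (hΓ.quells_of_neighbor hS h2 he hf hef hv hd hdS hdv)
  have hside' : ∀ f ∈ Γ.ds, f ≠ Γ.inv e → Γ.vert f = Γ.vert (Γ.inv e) → ∀ d ∈ Γ.ds,
      Γ.vert d = Γ.vert (Γ.inv f) → d ∉ S := fun f hf hef hv d hd hdv hdS =>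
    hQ (Quells.of_inv (hC.inv_inv e he)
      (hΓ.quells_of_neighbor hS h2 (hC.inv_mem e he) hf hef hv hd hdS hdv))
  have hfree : ∀ d ∈ Γ.ds, Γ.vert d = Γ.vert e → ∀ d' ∈ Γ.ds,
      Γ.vert d' = Γ.vert d ∨ Γ.vert d' = Γ.vert (Γ.inv d) → d' ∉ S := by
    rintro d hd hdv d' hd' (hv | hv) hS'
    · have hne : d' ≠ e := fun h => heS (h ▸ hS')
      exact hside d' hd' hne (hv.trans hdv) _ (hC.inv_mem d' hd') rfl (hS.inv_mem d' hd' hS')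
    · by_cases hde : d = e
      · subst hde
        have hne : d' ≠ Γ.inv d := fun h => heS (hsym d hd (h ▸ hS'))
        exact hside' d' hd' hne hv _ (hC.inv_mem d' hd') rfl (hS.inv_mem d' hd' hS')
      · exact hside d hd hde hdv d' hd' hv hS'
  obtain ⟨f, f', hx⟩ := exists_isStar hC he
  have hf := hx.mem_mid
  have hfv := hx.vert_mid
  obtain ⟨g, h, hz⟩ := exists_isStar hC (hC.inv_mem f hf)
  obtain ⟨k, l, hw⟩ := exists_isStar hC (hC.inv_mem g hz.mem_mid)
  have hfS : f ∉ S := hfree f hf hfv f hf (Or.inl rfl)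
  have hgS : g ∉ S := hfree f hf hfv g hz.mem_mid (Or.inr hz.vert_mid)
  have hhS : h ∉ S := hfree f hf hfv h hz.mem_right (Or.inr hz.vert_right)
  have higS : Γ.inv g ∉ S := fun h' => hgS (hsym g hz.mem_mid h')
  by_cases hkS : k ∈ S
  · have hlS : l ∈ S := by
      obtain ⟨d, hd, hv, hne, hdS⟩ := h2 k hw.mem_mid hkS
      rcases hw.cover d hd (hv.trans hw.vert_mid) with rfl | rfl | rfl
      · contradiction
      · contradiction
      · exact hdS
    obtain ⟨p, α, hu, hpS⟩ := h2.exists_isStar hC (hC.inv_mem k hw.mem_mid)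
      (hS.inv_mem k hw.mem_mid hkS)
    obtain ⟨γ, β, ht, hγS⟩ := h2.exists_isStar hC (hC.inv_mem p hu.mem_mid)
      (hS.inv_mem p hu.mem_mid hpS)
    exact hQ (hΓ.quells_of_path hS he hf hx.mid_ne_left hfv hz hw hu ht hkS hlS hpS hγS
      fun d hd hv => hfree d hd (hv.trans hfv))
  · have hlS : l ∉ S := fun hlS => by
      obtain ⟨d, hd, hv, hne, hdS⟩ := h2 l hw.mem_right hlS
      rcases hw.cover d hd (hv.trans hw.vert_right) with rfl | rfl | rfl <;> contradiction
    exact hQ (hΓ.quells_of_edge hS he hf hx.mid_ne_left hfv hz hw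
      fun _ => ⟨hfS, hhS, hkS, hlS⟩)

lemma card_contract_vs {Γ : DartGraph V D} {U : Finset V} {u : V} (hU : U ⊆ Γ.vs)
    (h2 : 2 ≤ U.card) : (Γ.contract U u).vs.card < Γ.vs.card := by
  classical
  have h := Finset.card_sdiff_add_card_eq_card hU
  have h' : (Γ.contract U u).vs.card ≤ (Γ.vs \ U).card + 1 := by
    unfold contract
    convert Finset.card_insert_le u (Γ.vs \ U)
  omega

/-- Every set of pairwise disjoint cycles of a bridgeless cubic multigraph can be made bipartite by
deleting a perfect matching through a given edge. -/
theorem quells_of_isCubic {Γ : DartGraph V D} (hΓ : Γ.IsCubic) {S : Set D} (hS : Γ.IsAdm S)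
    {e : D} (he : e ∈ Γ.ds) : Γ.Quells S e := by
  classical
  obtain ⟨n, hn⟩ : ∃ n, Γ.vs.card = n := ⟨_, rfl⟩
  induction n using Nat.strong_induction_on generalizing Γ S e with
  | _ n ihn =>
  obtain ⟨m, hm⟩ : ∃ m, (Γ.ds.filter (· ∈ S)).card = m := ⟨_, rfl⟩
  induction m using Nat.strong_induction_on generalizing S with
  | _ m ihm =>
  have prune : ∀ d ∈ Γ.ds, d ∈ S → Γ.Quells (S \ {d, Γ.inv d}) e := by
    intro d hd hdS
    refine ihm (Γ.ds.filter (· ∈ S \ {d, Γ.inv d})).card ?_ (hS.diff hΓ hd) (by congr)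
    rw [← hm]
    refine Finset.card_lt_card (Finset.ssubset_iff_of_subset ?_ |>.2 ⟨d, ?_, ?_⟩)
    · exact Finset.monotone_filter_right _ fun a _ ha => ha.1
    · simp [hd, hdS]
    · simp
  by_cases heS : e ∈ S
  · exact Quells.of_diff_self (prune e he heS)
  by_cases h2 : Γ.IsTwoReg S
  swap
  · unfold IsTwoReg at h2
    push Not at h2
    obtain ⟨d, hd, hdS, hpend⟩ := h2
    refine Quells.of_diff_pendant hΓ hS hd (fun d' hd' hv hS' => ?_) (prune d hd hdS)
    by_contra hne
    exact hpend d' hd' hv hne hS'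
  have heven := even_card_vs hΓ
  have hpos : 0 < Γ.vs.card := Finset.card_pos.2 ⟨_, hΓ.vert_mem e he⟩
  by_cases hn2 : Γ.vs.card = 2
  · exact quells_of_card_eq_two hΓ S he hn2
  by_cases hn4 : Γ.vs.card = 4
  · exact quells_of_card_eq_four hΓ S he hn4
  have h6 : 6 ≤ Γ.vs.card := by
    obtain ⟨r, hr⟩ := heven
    omega
  by_cases hcut : ∀ U ⊆ Γ.vs, Γ.cut U = 3 → 3 ≤ U.card → Γ.vs.card < U.card + 3
  · have hmin : Γ.IsMinimal := ⟨hΓ, noSmallCut_of hΓ h6 hcut, h6,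
      fun Γ' hΓ' hlt S' hS' e' he' => ihn _ (hn ▸ hlt) hΓ' hS' he' rfl⟩
    exact hmin.quells_of_isTwoReg hS h2 he heS
  · have reduce : ∀ U ⊆ Γ.vs, Γ.cut U = 3 → 3 ≤ U.card → 3 ≤ (Γ.vs \ U).card →
        ¬ (Γ.vert e ∈ U ∧ Γ.vert (Γ.inv e) ∈ U) → Γ.Quells S e := by
      intro U hU h3 hcU hcU' heU
      obtain ⟨u₀, hu₀⟩ := Finset.card_pos.1 (by omega : 0 < U.card)
      obtain ⟨u₁, hu₁⟩ := Finset.card_pos.1 (by omega : 0 < (Γ.vs \ U).card)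
      have hU' : Γ.vs \ U ⊆ Γ.vs := Finset.sdiff_subset
      have h3' : Γ.cut (Γ.vs \ U) = 3 := by rw [cut_sdiff hΓ, h3]
      refine Quells.glue hΓ hu₀ (Finset.mem_sdiff.1 hu₁).2 heU ?_ ?_
      · refine ihn _ ?_ (contract_isCubic hΓ hU hu₀ h3) (contract_isAdm hΓ hU h3 hS h2) ?_ rfl
        · rw [← hn]
          exact card_contract_vs hU (by omega)
        · simp only [contract, Finset.mem_filter]
          exact ⟨he, heU⟩
      · intro g hg
        refine ihn _ ?_ (contract_isCubic hΓ hU' hu₁ h3') (contract_isAdm hΓ hU' h3' hS h2) hg rfl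
        rw [← hn]
        exact card_contract_vs hU' (by omega)
    push Not at hcut
    obtain ⟨U, hU, h3, hcU, hcU'⟩ := hcut
    have hc := Finset.card_sdiff_add_card_eq_card hU
    by_cases heU : Γ.vert e ∈ U ∧ Γ.vert (Γ.inv e) ∈ U
    · refine reduce _ Finset.sdiff_subset (by rw [cut_sdiff hΓ, h3]) (by omega) ?_ ?_
      · rw [Finset.sdiff_sdiff_eq_self hU]
        exact hcU
      · simp [heU.1]
    · exact reduce U hU h3 hcU (by omega) heU

end DartGraph

open Classical in
/-- The darts of a simple graph. -/
noncomputable def dartGraph [Fintype V] (G : SimpleGraph V) : DartGraph V G.Dart where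
  vs := Finset.univ
  ds := Finset.univ
  vert := fun d => d.fst
  inv := Dart.symm

lemma dartGraph_isCubic [Fintype V] {G : SimpleGraph V} (hconn : TwoConnected G)
    (hreg : IsRegular G 3) : (dartGraph G).IsCubic := by
  classical
  refine ⟨fun _ _ => Finset.mem_univ _, fun _ _ => Finset.mem_univ _, fun d _ => d.symm_symm,
    fun d _ => d.symm_ne, fun v _ => ?_, fun U _ hne hU => ?_⟩
  · have h := G.dart_fst_fiber_card_eq_degree v
    have h' := hreg v
    rw [Set.ncard_eq_toFinset_card', Set.toFinset_card, G.card_neighborSet_eq_degree] at h'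
    rw [← h', ← h]
    simp only [dartGraph]
    congr
  · obtain ⟨x, hx⟩ := hne
    obtain ⟨y, hy⟩ : ∃ y, y ∉ U := by
      by_contra! h
      exact hU (Finset.eq_univ_iff_forall.2 h)
    obtain ⟨p⟩ := hconn.1.preconnected x y
    obtain ⟨d, -, hd, hd'⟩ := p.exists_boundary_dart U hx hy
    suffices h : ∃ d' : G.Dart, d'.fst ∈ U ∧ d'.snd ∉ U ∧ d' ≠ d by
      obtain ⟨d', h1, h2, h3⟩ := h
      rw [← Finset.card_pair h3]
      refine Finset.card_le_card fun a ha => ?_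
      simp only [Finset.mem_insert, Finset.mem_singleton] at ha
      refine Finset.mem_filter.2 ⟨Finset.mem_univ _, ?_⟩
      rcases ha with rfl | rfl
      · exact ⟨h1, h2⟩
      · exact ⟨hd, hd'⟩
    obtain ⟨c, hc, hcd⟩ : ∃ c, G.Adj d.fst c ∧ c ≠ d.snd :=
      Set.exists_ne_of_one_lt_ncard (s := G.neighborSet d.fst) (by rw [hreg]; norm_num) d.snd
    by_cases hcU : c ∈ U
    · obtain ⟨q⟩ := (hconn.2.2 d.fst).preconnected ⟨c, hc.ne'⟩ ⟨d.snd, d.adj.ne'⟩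
      obtain ⟨a, -, ha, ha'⟩ := q.exists_boundary_dart {v | v.1 ∈ U} hcU hd'
      exact ⟨⟨(a.fst.1, a.snd.1), a.adj⟩, ha, ha', fun h =>
        a.fst.2 (congrArg (fun d => d.fst) h)⟩
    · exact ⟨⟨(d.fst, c), hc⟩, hd, hcU, fun h => hcd (by rw [← h])⟩

lemma exists_adj_notMem [Fintype V] {G : SimpleGraph V} (hreg : IsRegular G 3)
    {𝒪 : Set G.Subgraph} (hcyc : ∀ O ∈ 𝒪, IsCycleSG O) (hdisj : PairwiseEdgeDisjoint 𝒪) (v : V) :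
    ∃ w, G.Adj v w ∧ ∀ O ∈ 𝒪, ¬ O.Adj v w := by
  by_contra! hcon
  have hsub : ∀ O : G.Subgraph, O.neighborSet v ⊆ G.neighborSet v := fun O => O.neighborSet_subset v
  have hv := hreg v
  have hdeg : ∀ O ∈ 𝒪, ∀ w, O.Adj v w → (O.neighborSet v).ncard = 2 :=
    fun O hO w hw => (hcyc O hO).2 v hw.fst_mem
  obtain ⟨w, hw⟩ : (G.neighborSet v).Nonempty := Set.nonempty_of_ncard_ne_zero (by omega)
  obtain ⟨O, hO, hOw⟩ := hcon w hw
  have h2 := hdeg O hO w hOw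
  obtain ⟨w', hw', hOw'⟩ := Set.exists_mem_notMem_of_ncard_lt_ncard (h2.trans_lt (by omega) :
    (O.neighborSet v).ncard < (G.neighborSet v).ncard)
  obtain ⟨O', hO', hO'w'⟩ := hcon w' hw'
  have h2' := hdeg O' hO' w' hO'w'
  have hne : O ≠ O' := by
    rintro rfl
    exact hOw' hO'w'
  have hd : Disjoint (O.neighborSet v) (O'.neighborSet v) := by
    refine Set.disjoint_left.2 fun x hx hx' => ?_
    exact Set.disjoint_left.1 (hdisj hO hO' hne) (Subgraph.mem_edgeSet.2 hx)
      (Subgraph.mem_edgeSet.2 hx')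
  have h4 := Set.ncard_union_eq hd
  have := Set.ncard_le_ncard (Set.union_subset (hsub O) (hsub O'))
  omega

/-- A properly `2`-coloured cycle has an even number of edges. -/
lemma IsCycleSG.even_ncard_edgeSet [Fintype V] {G : SimpleGraph V} {C : G.Subgraph}
    (hC : IsCycleSG C) (c : V → Bool) (hc : ∀ u v, C.Adj u v → c u ≠ c v) :
    Even C.edgeSet.ncard := by
  classical
  have hb : C.spanningCoe.IsBipartiteWith
      ((Finset.univ.filter fun v => c v = true : Finset V) : Set V)
      ((Finset.univ.filter fun v => c v = false : Finset V) : Set V) := by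
    refine ⟨?_, fun u v huv => ?_⟩
    · rw [Finset.disjoint_coe, Finset.disjoint_left]
      intro v h1 h2
      simp_all
    · have := hc u v huv
      cases hu : c u <;> cases hv : c v <;> simp_all
  have h := isBipartiteWith_sum_degrees_eq_card_edges hb
  have hcard : C.edgeSet.ncard = C.spanningCoe.edgeFinset.card := by
    rw [← Set.ncard_coe_finset, coe_edgeFinset, Subgraph.edgeSet_spanningCoe]
  rw [hcard, ← h]
  refine Finset.even_sum _ fun v _ => ?_
  have hdeg : C.spanningCoe.degree v = sdeg C v := by
    rw [← card_neighborSet_eq_degree, ← Set.toFinset_card, ← Set.ncard_eq_toFinset_card']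
    rfl
  rw [hdeg]
  by_cases hv : v ∈ C.verts
  · rw [hC.2 v hv]
    exact even_two
  · have : C.neighborSet v = ∅ := by
      ext w
      simpa using fun h : C.Adj v w => hv h.fst_mem
    simp [sdeg, this]

/-- Kardoš–Máčajová–Zerafa: in a 2-connected cubic graph, for any set of pairwise
edge-disjoint odd cycles and any edge `e`, there is a perfect matching containing `e`
and meeting every cycle of the set. -/
theorem stmt_0 {V : Type*} [Fintype V] (G : SimpleGraph V)
    (hconn : TwoConnected G) (hreg : IsRegular G 3)
    (𝒪 : Set G.Subgraph) (hodd : ∀ O ∈ 𝒪, IsOddCycleSG O)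
    (hdisj : PairwiseEdgeDisjoint 𝒪)
    (e : Sym2 V) (he : e ∈ G.edgeSet) :
    ∃ F : G.Subgraph, IsTFactor F 1 ∧ e ∈ F.edgeSet ∧
      ∀ O ∈ 𝒪, (F.edgeSet ∩ O.edgeSet).Nonempty := by
  classical
  have hcyc : ∀ O ∈ 𝒪, IsCycleSG O := fun O hO => (hodd O hO).1
  have hadm : (dartGraph G).IsAdm {d | ∃ O ∈ 𝒪, O.Adj d.fst d.snd} := by
    refine ⟨fun d _ ⟨O, hO, h⟩ => ⟨O, hO, h.symm⟩, fun v _ => ?_⟩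
    obtain ⟨w, hw, h⟩ := exists_adj_notMem hreg hcyc hdisj v
    exact ⟨⟨(v, w), hw⟩, Finset.mem_univ _, rfl, fun ⟨O, hO, h'⟩ => h O hO h'⟩
  induction e with
  | _ a b =>
  obtain ⟨M, c, hM, heM, hc⟩ := DartGraph.quells_of_isCubic (dartGraph_isCubic hconn hreg) hadm
    (Finset.mem_univ (⟨(a, b), he⟩ : G.Dart))
  let F : G.Subgraph :=
    { verts := Set.univ
      Adj := fun u v => ∃ h : G.Adj u v, ⟨(u, v), h⟩ ∈ M
      adj_sub := fun h => h.1
      edge_vert := fun _ => Set.mem_univ _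
      symm := ⟨fun u v h => ⟨h.1.symm, hM.inv_mem _ h.2⟩⟩ }
  refine ⟨F, ⟨fun v => Set.mem_univ v, fun v => ?_⟩, ⟨he, heM⟩, fun O hO => ?_⟩
  · obtain ⟨d, hd, rfl⟩ := hM.exists_mem v (Finset.mem_univ v)
    refine Set.ncard_eq_one.2 ⟨d.snd, Set.ext fun w => ⟨fun ⟨h, hw⟩ => ?_, ?_⟩⟩
    · rw [← hM.eq_of_vert_eq _ hw d hd rfl]
      rfl
    · rintro rfl
      exact ⟨d.adj, hd⟩
  · by_contra hempty
    refine Nat.not_even_iff_odd.2 (hodd O hO).2 ((hcyc O hO).even_ncard_edgeSet c fun u v huv => ?_)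
    refine hc ⟨(u, v), huv.adj_sub⟩ (Finset.mem_univ _) ⟨O, hO, huv⟩ fun h => hempty ?_
    exact ⟨s(u, v), ⟨huv.adj_sub, h⟩, huv⟩

end PaperFormalization
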